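/- The augmentation ideal of the extended Dickson algebra is not directly decomposable as a Steenrod module: let p be an odd prime, D_n = A_n^{GL_n(F_p)} the extended Dickson algebra, and D_n⁺ ⊆ D_n its subspace of elements of positive degree (which is stable under β and under all P^k). If M and N are graded F_p-linear subspaces of D_n⁺, each stable under β and under every Steenrod operation P^k, such that D_n⁺ = M ⊕ N, then M = 0 or N = 0. -/

import Mathlib

open MvPolynomial Matrix
open scoped TensorProduct

set_option synthInstance.maxHeartbeats 1000000
set_option maxHeartbeats 1000000

/-- The algebra `A_n = E(x_1,...,x_n) ⊗ F_p[y_1,...,y_n]` (the mod-`p` cohomology of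
`B(ℤ/p)^n`); since the polynomial factor is concentrated in even degrees this agrees with
the ordinary tensor product of algebras. -/
abbrev ExtA (p n : ℕ) :=
  ExteriorAlgebra (ZMod p) (Fin n → ZMod p) ⊗[ZMod p] MvPolynomial (Fin n) (ZMod p)

/-- The exterior generator `x_i` of `A_n` (of degree 1). -/
noncomputable def xgen (p n : ℕ) (i : Fin n) : ExtA p n :=
  ExteriorAlgebra.ι (ZMod p) (Pi.single i 1) ⊗ₜ 1

/-- The polynomial generator `y_i` of `A_n` (of degree 2). -/
noncomputable def ygen (p n : ℕ) (i : Fin n) : ExtA p n :=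
  1 ⊗ₜ X i

/-- The degree-`k` homogeneous component of `A_n`, where `x`'s have degree 1 and `y`'s
degree 2: the span of the elements `a ⊗ f` with `a` of exterior degree `i`, `f` homogeneous
of polynomial degree `j`, and `i + 2j = k`. -/
noncomputable def extComp (p n k : ℕ) : Submodule (ZMod p) (ExtA p n) :=
  Submodule.span (ZMod p)
    { z | ∃ i j : ℕ, i + 2 * j = k ∧
        ∃ (a : ExteriorAlgebra (ZMod p) (Fin n → ZMod p))
          (f : MvPolynomial (Fin n) (ZMod p)),
          a ∈ (LinearMap.range (ExteriorAlgebra.ι (ZMod p) :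
                (Fin n → ZMod p) →ₗ[ZMod p] ExteriorAlgebra (ZMod p) (Fin n → ZMod p))) ^ i ∧
          f.IsHomogeneous j ∧ z = a ⊗ₜ f }

/-- The action of `g ∈ GL_n(F_p)` on `A_n` by simultaneous linear substitution of the `x`'s
and the `y`'s. -/
noncomputable def glActExt (p n : ℕ) (g : GL (Fin n) (ZMod p)) :
    ExtA p n →ₐ[ZMod p] ExtA p n :=
  Algebra.TensorProduct.map
    (ExteriorAlgebra.map (Matrix.toLin' (g : Matrix (Fin n) (Fin n) (ZMod p))))
    (aeval fun i => ∑ j, C ((g : Matrix (Fin n) (Fin n) (ZMod p)) j i) * X j)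

/-- The extended Dickson algebra `D_n = A_n^{GL_n(F_p)}`, as a submodule of `A_n`. -/
noncomputable def extDn (p n : ℕ) : Submodule (ZMod p) (ExtA p n) :=
  ⨅ g : GL (Fin n) (ZMod p),
    LinearMap.ker ((glActExt p n g).toLinearMap - LinearMap.id)

/-- The positive-degree part `D_n⁺` of the extended Dickson algebra. -/
noncomputable def extDnPlus (p n : ℕ) : Submodule (ZMod p) (ExtA p n) :=
  extDn p n ⊓ ⨆ (k : ℕ) (_ : 0 < k), extComp p n k

section AdditiveSubstitution

variable {σ K : Type*} [Field K] (p : ℕ)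

/-- The substitution `X i ↦ ∑ j ≤ N, a j * X i ^ p ^ j` by an additive polynomial. -/
noncomputable def additiveSubst (N : ℕ) (a : ℕ → K) : MvPolynomial σ K →ₐ[K] MvPolynomial σ K :=
  aeval fun i => ∑ j ∈ Finset.range (N + 1), C (a j) * X i ^ p ^ j

lemma exists_additive_factor [Fact p.Prime] [CharP K p] [IsAlgClosed K] (N : ℕ) (a : ℕ → K)
    (h0 : a 0 ≠ 0) (hN : a (N + 1) ≠ 0) :
    ∃ (c : K) (b : ℕ → K), c ≠ 0 ∧ b 0 ≠ 0 ∧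
      (additiveSubst p (N + 1) a : MvPolynomial σ K →ₐ[K] MvPolynomial σ K) =
        (aeval fun i => C (-c) * X i + C 1 * X i ^ p).comp (additiveSubst p N b) := by
  have hp := (Fact.out : p.Prime)
  let s : ℕ → ℕ := fun j => ∑ i ∈ Finset.range j, p ^ i
  have hs : ∀ j, s (j + 1) = s j + p ^ j := fun j => Finset.sum_range_succ _ _
  have hsm : StrictMono s := strictMono_nat_of_lt_succ fun j => by
    rw [hs]; have := pow_pos hp.pos j; omega
  let E : Polynomial K := ∑ j ∈ Finset.range (N + 2), Polynomial.monomial (s j) (a j)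
  have hE : E.coeff (s (N + 1)) = a (N + 1) := by
    simp [E, Polynomial.coeff_monomial, hsm.injective.eq_iff]
  have hdeg : E.degree ≠ 0 := by
    intro h
    have h1 := Polynomial.le_degree_of_ne_zero (hE.symm ▸ hN : E.coeff (s (N + 1)) ≠ 0)
    rw [h] at h1
    have h2 : 0 < s (N + 1) := lt_of_le_of_lt (Nat.zero_le _) (hsm (Nat.lt_succ_self N))
    have h3 : s (N + 1) ≤ 0 := by exact_mod_cast h1
    omega
  obtain ⟨c, hc⟩ := IsAlgClosed.exists_root E hdeg
  have hroot : ∑ j ∈ Finset.range (N + 2), a j * c ^ s j = 0 := by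
    simpa [E, Polynomial.IsRoot, Polynomial.eval_finsetSum, Polynomial.eval_monomial] using hc
  have hs0 : s 0 = 0 := by simp [s]
  have hc0 : c ≠ 0 := by
    rintro rfl
    rw [Finset.sum_range_succ'] at hroot
    rw [Finset.sum_eq_zero, hs0] at hroot
    · simp [h0] at hroot
    · intro j _
      have : s (j + 1) ≠ 0 := by
        have := hsm (Nat.succ_pos j); simp only [Nat.succ_eq_add_one] at this; omega
      rw [zero_pow this, mul_zero]
  let b : ℕ → K := fun j => Nat.rec (-(a 0) / c) (fun j r => (r - a (j + 1)) / c ^ p ^ (j + 1)) j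
  have hb0 : b 0 = -(a 0) / c := rfl
  have hb : ∀ j, b (j + 1) = (b j - a (j + 1)) / c ^ p ^ (j + 1) := fun j => rfl
  have key : ∀ j, b j * c ^ s (j + 1) = -∑ i ∈ Finset.range (j + 1), a i * c ^ s i := by
    intro j
    induction j with
    | zero => simp [hb0, hs, hs0]; field_simp
    | succ j ih =>
      rw [Finset.sum_range_succ, neg_add, ← ih, hb, hs (j + 1), pow_add]
      field_simp
      ring
  have hbN : b N = a (N + 1) := by
    have h1 := key N
    rw [Finset.sum_range_succ] at hroot
    rw [← eq_neg_iff_add_eq_zero] at hroot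
    rw [hroot, neg_neg] at h1
    exact mul_right_cancel₀ (pow_ne_zero _ hc0) h1
  refine ⟨c, b, hc0, by rw [hb0]; exact div_ne_zero (neg_ne_zero.2 h0) hc0, ?_⟩
  apply MvPolynomial.algHom_ext
  intro i
  have tele : ∀ j, ∑ i' ∈ Finset.range (j + 1),
      C (b i') * (C (-c) * X i + C 1 * X i ^ p : MvPolynomial σ K) ^ p ^ i' =
      ∑ i' ∈ Finset.range (j + 1), C (a i') * X i ^ p ^ i' + C (b j) * X i ^ p ^ (j + 1) := by
    intro j
    induction j with
    | zero =>
      simp only [zero_add, Finset.sum_range_one, pow_zero, pow_one, C_1, one_mul, mul_add,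
        ← mul_assoc, ← C_mul]
      congr 3
      rw [hb0]; field_simp
    | succ j ih =>
      rw [Finset.sum_range_succ, ih, Finset.sum_range_succ _ (j + 1), add_pow_char_pow, mul_pow,
        C_1, one_mul, ← C_pow, mul_add, ← mul_assoc, ← C_mul, ← pow_mul, ← pow_succ' p]
      have h1 : b (j + 1) * (-c) ^ p ^ (j + 1) = a (j + 1) - b j := by
        rw [neg_pow, hb, neg_one_pow_char_pow]
        field_simp
        ring
      rw [h1, C_sub]
      ring
  simp only [additiveSubst, aeval_X, AlgHom.comp_apply, map_sum, map_mul, map_pow, algHom_C]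
  rw [Finset.sum_range_succ, ← hbN]
  exact (tele N).symm

/-- Additive substitutions with nonzero linear coefficient are compositions of those of the form
`X i ↦ a * X i + τ * X i ^ p`. -/
lemma additiveSubst_mem [Fact p.Prime] [CharP K p] [IsAlgClosed K]
    (W : Submodule K (MvPolynomial σ K))
    (hW : ∀ a τ : K, a ≠ 0 → ∀ g ∈ W,
      aeval (fun i => C a * X i + C τ * X i ^ p : σ → MvPolynomial σ K) g ∈ W)
    (N : ℕ) (a : ℕ → K) (h0 : a 0 ≠ 0) {g : MvPolynomial σ K} (hg : g ∈ W) :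
    additiveSubst p N a g ∈ W := by
  induction N generalizing a with
  | zero =>
    have : (additiveSubst p 0 a : MvPolynomial σ K →ₐ[K] MvPolynomial σ K) =
        aeval (fun i => C (a 0) * X i + C 0 * X i ^ p) := by
      simp only [additiveSubst, zero_add, Finset.sum_range_one, pow_zero, pow_one, C_0, zero_mul,
        add_zero]
    rw [this]
    exact hW (a 0) 0 h0 g hg
  | succ N ih =>
    by_cases hN : a (N + 1) = 0
    · have : (additiveSubst p (N + 1) a : MvPolynomial σ K →ₐ[K] MvPolynomial σ K) =
          additiveSubst p N a := by
        simp [additiveSubst, Finset.sum_range_succ _ (N + 1), hN]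
      rw [this]
      exact ih a h0
    · obtain ⟨c, b, hc, hb, h⟩ := exists_additive_factor (σ := σ) p N a h0 hN
      rw [h, AlgHom.comp_apply]
      exact hW (-c) 1 (neg_ne_zero.2 hc) _ (ih b hb)

end AdditiveSubstitution

section Descent

variable {σ k K : Type*} [Field k] [Field K] [Algebra k K]

lemma mem_of_map_mem_span (s : Submodule k (MvPolynomial σ k)) {g : MvPolynomial σ k}
    (h : map (algebraMap k K) g ∈
      Submodule.span K (map (algebraMap k K) '' (s : Set (MvPolynomial σ k)))) : g ∈ s := by
  by_contra hne
  obtain ⟨θ, hθ, hθs⟩ := Submodule.exists_le_ker_of_notMem hne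
  let θK : MvPolynomial σ K →ₗ[K] K :=
    (basisMonomials σ K).constr K fun m => algebraMap k K (θ (monomial m 1))
  have hθK : ∀ f : MvPolynomial σ k, θK (map (algebraMap k K) f) = algebraMap k K (θ f) := by
    intro f
    induction f using MvPolynomial.induction_on' with
    | monomial u a =>
      have h1 : θK (monomial u 1) = algebraMap k K (θ (monomial u 1)) := by
        simpa using (basisMonomials σ K).constr_basis K
          (fun m => algebraMap k K (θ (monomial m 1))) u
      have h2 : (monomial u (algebraMap k K a) : MvPolynomial σ K) =
          algebraMap k K a • monomial u 1 := by
        rw [smul_monomial, smul_eq_mul, mul_one]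
      have h3 : (monomial u a : MvPolynomial σ k) = a • monomial u 1 := by
        rw [smul_monomial, smul_eq_mul, mul_one]
      rw [map_monomial, h2, map_smul, h1, h3, map_smul, smul_eq_mul, smul_eq_mul, map_mul]
    | add f g hf hg => rw [map_add, map_add, hf, hg, map_add, map_add]
  have hle : Submodule.span K (map (algebraMap k K) '' (s : Set (MvPolynomial σ k))) ≤
      LinearMap.ker θK := by
    rw [Submodule.span_le]
    rintro _ ⟨f, hf, rfl⟩
    rw [SetLike.mem_coe, LinearMap.mem_ker, hθK, LinearMap.mem_ker.1 (hθs hf), map_zero]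
  have := LinearMap.mem_ker.1 (hle h)
  rw [hθK] at this
  exact hθ ((map_eq_zero _).1 this)

/-- If the values of a polynomial with coefficients in a space `E` lie in a subspace `W` away from
a hypersurface, then its coefficients lie in `W`. -/
lemma coeff_mem_of_eval_mem {τ : Type*} [Infinite K]
    (W : Submodule K (MvPolynomial σ K)) (G : MvPolynomial τ (MvPolynomial σ K))
    (g : MvPolynomial τ K) (hg : g ≠ 0)
    (h : ∀ β : τ → K, eval β g ≠ 0 → eval (fun l => C (β l)) G ∈ W) (e : τ →₀ ℕ) :
    coeff e G ∈ W := by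
  classical
  by_contra hne
  obtain ⟨θ, hθ, hθW⟩ := Submodule.exists_le_ker_of_notMem hne
  let H : MvPolynomial τ K := ∑ u ∈ G.support, monomial u (θ (coeff u G))
  have hH : ∀ β, eval β H = θ (eval (fun l => C (β l)) G) := by
    intro β
    rw [eval_eq (fun l => C (β l)), map_sum θ]
    simp only [H, map_sum, eval_monomial]
    refine Finset.sum_congr rfl fun u _ => ?_
    have : coeff u G * ∏ i ∈ u.support, (C (β i) : MvPolynomial σ K) ^ u i =
        (∏ i ∈ u.support, β i ^ u i) • coeff u G := by
      rw [smul_eq_C_mul, mul_comm, map_prod]; simp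
    rw [this, map_smul, smul_eq_mul, mul_comm, Finsupp.prod]
  have h0 : H * g = 0 := by
    apply MvPolynomial.funext
    intro β
    rw [map_mul, map_zero, hH]
    by_cases hb : eval β g = 0
    · rw [hb, mul_zero]
    · rw [LinearMap.mem_ker.1 (hθW (h β hb)), zero_mul]
  have h1 : coeff e H = θ (coeff e G) := by
    simp only [H, coeff_sum, coeff_monomial, Finset.sum_ite_eq']
    split_ifs with h
    · rfl
    · rw [notMem_support_iff.1 h, map_zero]
  rw [(mul_eq_zero.1 h0).resolve_right hg] at h1
  exact hθ (by rw [← h1, coeff_zero])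

end Descent

section PowerSums

/-- `a` is a sum of at most `m` powers of `p`. -/
def IsPowSum (p m a : ℕ) : Prop :=
  ∃ s : Multiset ℕ, Multiset.card s ≤ m ∧ (s.map (p ^ ·)).sum = a

lemma IsPowSum.zero (p m : ℕ) : IsPowSum p m 0 := ⟨0, by simp, by simp⟩

lemma IsPowSum.pow (p j : ℕ) : IsPowSum p 1 (p ^ j) := ⟨{j}, by simp, by simp⟩

lemma IsPowSum.add {p m m' a a' : ℕ} (h : IsPowSum p m a) (h' : IsPowSum p m' a') :
    IsPowSum p (m + m') (a + a') := by
  obtain ⟨s, hs, rfl⟩ := h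
  obtain ⟨s', hs', rfl⟩ := h'
  exact ⟨s + s', by rw [Multiset.card_add]; omega, by simp⟩

lemma IsPowSum.mono {p m m' a : ℕ} (h : IsPowSum p m a) (hm : m ≤ m') : IsPowSum p m' a := by
  obtain ⟨s, hs, rfl⟩ := h
  exact ⟨s, hs.trans hm, rfl⟩

lemma le_card_of_pow_dvd_sum_add_one {p : ℕ} (hp : 2 ≤ p) (T : ℕ) (s : Multiset ℕ)
    (h : p ^ T ∣ (s.map (p ^ ·)).sum + 1) : T ≤ Multiset.card s := by
  induction T generalizing s with
  | zero => exact Nat.zero_le _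
  | succ T ih =>
    let s₀ := s.filter (· = 0)
    let s₁ := s.filter (¬ · = 0)
    have hs : s₀ + s₁ = s := Multiset.filter_add_not _ _
    have h₀ : (s₀.map (p ^ ·)).sum = Multiset.card s₀ := by
      have : s₀.map (p ^ ·) = s₀.map fun _ => 1 := by
        refine Multiset.map_congr rfl fun j hj => ?_
        rw [(Multiset.mem_filter.1 hj).2, pow_zero]
      rw [this]; simp
    have h₁ : (s₁.map (p ^ ·)).sum = p * ((s₁.map Nat.pred).map (p ^ ·)).sum := by
      rw [Multiset.map_map, ← Multiset.sum_map_mul_left]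
      congr 1
      refine Multiset.map_congr rfl fun j hj => ?_
      have hj0 : j ≠ 0 := (Multiset.mem_filter.1 hj).2
      obtain ⟨i, rfl⟩ := Nat.exists_eq_succ_of_ne_zero hj0
      simp [pow_succ']
    have hcard : Multiset.card s = Multiset.card s₀ + Multiset.card s₁ := by
      rw [← Multiset.card_add, hs]
    rw [← hs, Multiset.map_add, Multiset.sum_add, h₀, h₁] at h
    have hd : p ∣ Multiset.card s₀ + 1 := by
      have h2 : p ∣ Multiset.card s₀ + p * ((s₁.map Nat.pred).map (p ^ ·)).sum + 1 :=
        (dvd_pow_self p (Nat.succ_ne_zero T)).trans h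
      have h3 : Multiset.card s₀ + p * ((s₁.map Nat.pred).map (p ^ ·)).sum + 1 =
        p * ((s₁.map Nat.pred).map (p ^ ·)).sum + (Multiset.card s₀ + 1) := by ring
      rw [h3] at h2
      exact (Nat.dvd_add_right (dvd_mul_right _ _)).1 h2
    obtain ⟨u, hu⟩ := hd
    have hu1 : 1 ≤ u := by
      rcases Nat.eq_zero_or_pos u with rfl | h
      · simp at hu
      · exact h
    have := ih (s₁.map Nat.pred + Multiset.replicate (u - 1) 0) (by
      have h4 : Multiset.card s₀ + p * ((s₁.map Nat.pred).map (p ^ ·)).sum + 1 =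
          p * (((s₁.map Nat.pred).map (p ^ ·)).sum + u) := by rw [mul_add, ← hu]; ring
      rw [h4, pow_succ'] at h
      have h5 := Nat.dvd_of_mul_dvd_mul_left (by omega) h
      rw [Multiset.map_add, Multiset.sum_add, Multiset.map_replicate, Multiset.sum_replicate]
      simpa [add_assoc, Nat.sub_add_cancel hu1] using h5)
    rw [Multiset.card_add, Multiset.card_map, Multiset.card_replicate] at this
    have : 2 * u ≤ p * u := Nat.mul_le_mul_right _ hp
    omega

lemma IsPowSum.le_of_pow_dvd {p m a T : ℕ} (hp : 2 ≤ p) (h : IsPowSum p m a)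
    (hT : p ^ T ∣ a + 1) : T ≤ m := by
  obtain ⟨s, hs, rfl⟩ := h
  exact (le_card_of_pow_dvd_sum_add_one hp T s hT).trans hs

end PowerSums

section Traces

variable {ι τ B : Type*} [CommRing B] (p : ℕ)

/-- The truncation `∑ j ≤ N l, (y i * β l) ^ p ^ j` of a formal solution of `ℓ ^ p = ℓ`, as a
polynomial in the variables `β`. -/
noncomputable def truncTrace (N : τ → ℕ) (y : ι → B) (i : ι) (l : τ) : MvPolynomial τ B :=
  ∑ j ∈ Finset.range (N l + 1), (C (y i) * X l) ^ p ^ j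

lemma truncTrace_pow_sub [Fact p.Prime] [CharP B p] (N : τ → ℕ) (y : ι → B) (i : ι) (l : τ) :
    truncTrace p N y i l ^ p - truncTrace p N y i l =
      (C (y i) * X l) ^ p ^ (N l + 1) - C (y i) * X l := by
  rw [truncTrace, sum_pow_char]
  simp_rw [← pow_mul, ← pow_succ]
  rw [← Finset.sum_sub_distrib, Finset.sum_range_sub (fun j => (C (y i) * X l) ^ p ^ j)]
  simp

lemma C_mul_X_pow (b : B) (l : τ) (k : ℕ) :
    (C b * X l : MvPolynomial τ B) ^ k = monomial (Finsupp.single l k) (b ^ k) := by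
  rw [mul_pow, ← C_pow, C_mul_X_pow_eq_monomial]

lemma mem_support_truncTrace {N : τ → ℕ} {y : ι → B} {i : ι} {l : τ} {u : τ →₀ ℕ}
    (hu : u ∈ (truncTrace p N y i l).support) : ∃ j ≤ N l, u = Finsupp.single l (p ^ j) := by
  classical
  have := support_sum hu
  simp only [Finset.mem_biUnion, Finset.mem_range, C_mul_X_pow] at this
  obtain ⟨j, hj, hju⟩ := this
  exact ⟨j, by omega, Finset.mem_singleton.1 (support_monomial_subset hju)⟩

lemma exists_isPowSum_of_mem_support {K : Type*} [CommRing K] [Algebra K B]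
    (q : MvPolynomial (ι × τ) K) :
    ∃ m, ∀ (N : τ → ℕ) (y : ι → B),
      ∀ u ∈ (aeval (fun s : ι × τ => truncTrace p N y s.1 s.2) q).support,
        ∀ l, IsPowSum p m (u l) := by
  classical
  induction q using MvPolynomial.induction_on with
  | C a =>
    refine ⟨0, fun N y u hu l => ?_⟩
    rw [algHom_C, MvPolynomial.algebraMap_apply] at hu
    have := Finset.mem_singleton.1 (support_monomial_subset hu)
    rw [this]
    exact IsPowSum.zero p 0
  | add q q' h h' =>
    obtain ⟨m, hm⟩ := h
    obtain ⟨m', hm'⟩ := h'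
    refine ⟨max m m', fun N y u hu l => ?_⟩
    rw [map_add] at hu
    rcases Finset.mem_union.1 (support_add hu) with hu | hu
    · exact (hm N y u hu l).mono (le_max_left _ _)
    · exact (hm' N y u hu l).mono (le_max_right _ _)
  | mul_X q s h =>
    obtain ⟨m, hm⟩ := h
    refine ⟨m + 1, fun N y u hu l => ?_⟩
    rw [map_mul, aeval_X] at hu
    obtain ⟨v, hv, w, hw, rfl⟩ := Finset.mem_add.1 (support_mul _ _ hu)
    obtain ⟨j, -, rfl⟩ := mem_support_truncTrace p hw
    refine (hm N y v hv l).add ?_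
    rw [Finsupp.single_apply]
    split_ifs
    · exact IsPowSum.pow p j
    · exact IsPowSum.zero p 1

lemma coeff_mul_truncTrace_pow_sub [Fact p.Prime] [CharP B p] {m : ℕ} {F : MvPolynomial τ B}
    (hF : ∀ u ∈ F.support, ∀ l, IsPowSum p m (u l)) {N : τ → ℕ} (hN : ∀ l, m < N l)
    (y : ι → B) (i : ι) (l : τ) {e : τ →₀ ℕ} (he : ∀ l, e l = (p - 1) * p ^ N l) :
    coeff e (F * (truncTrace p N y i l ^ p - truncTrace p N y i l)) = 0 := by
  classical
  have hp := (Fact.out : p.Prime)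
  rw [truncTrace_pow_sub, mul_sub, coeff_sub, C_mul_X_pow, C_mul_X_eq_monomial,
    coeff_mul_monomial', coeff_mul_monomial']
  rw [if_neg, zero_sub, neg_eq_zero]
  · split_ifs with h
    · have h1 : coeff (e - Finsupp.single l 1) F = 0 := by
        by_contra hne
        have h2 := hF _ (mem_support_iff.2 hne) l
        have h3 : (e - Finsupp.single l 1 : τ →₀ ℕ) l + 1 = e l := by
          have := h l
          simp only [Finsupp.single_eq_same] at this
          simp only [Finsupp.coe_tsub, Pi.sub_apply, Finsupp.single_eq_same]
          omega
        have := h2.le_of_pow_dvd hp.two_le (T := N l) (by rw [h3, he]; exact dvd_mul_left _ _)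
        have := hN l
        omega
      rw [h1, zero_mul]
    · rfl
  · intro h
    have := h l
    rw [Finsupp.single_eq_same, he, pow_succ'] at this
    have h1 := Nat.le_of_mul_le_mul_right this (pow_pos hp.pos _)
    have := hp.pos
    omega

/-- `F` is supported in degrees `≤ u` and has coefficient `a` in degree `u`. -/
def HasTopCoeff (F : MvPolynomial τ B) (u : τ →₀ ℕ) (a : B) : Prop :=
  (∀ v ∈ F.support, v ≤ u) ∧ coeff u F = a

lemma HasTopCoeff.mul {F G : MvPolynomial τ B} {u v : τ →₀ ℕ} {a b : B}
    (hF : HasTopCoeff F u a) (hG : HasTopCoeff G v b) : HasTopCoeff (F * G) (u + v) (a * b) := by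
  classical
  constructor
  · intro w hw
    obtain ⟨w₁, h₁, w₂, h₂, rfl⟩ := Finset.mem_add.1 (support_mul _ _ hw)
    exact add_le_add (hF.1 _ h₁) (hG.1 _ h₂)
  · rw [coeff_mul, Finset.sum_eq_single (u, v), hF.2, hG.2]
    · rintro ⟨w₁, w₂⟩ hw hne
      by_contra h
      have h₁ := hF.1 w₁ (mem_support_iff.2 (left_ne_zero_of_mul h))
      have h₂ := hG.1 w₂ (mem_support_iff.2 (right_ne_zero_of_mul h))
      have hw : w₁ + w₂ = u + v := Finset.HasAntidiagonal.mem_antidiagonal.1 hw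
      apply hne
      have e₁ : w₁ = u := by
        ext l
        have := DFunLike.congr_fun hw l
        have := h₁ l
        have := h₂ l
        simp only [Finsupp.add_apply] at *
        omega
      subst e₁
      rw [add_left_cancel hw]
    · intro h
      exact absurd (Finset.HasAntidiagonal.mem_antidiagonal.2 (rfl : u + v = u + v)) h

lemma HasTopCoeff.sum {α : Type*} (s : Finset α) {F : α → MvPolynomial τ B} {u : τ →₀ ℕ}
    {a : α → B} (h : ∀ i ∈ s, HasTopCoeff (F i) u (a i)) :
    HasTopCoeff (∑ i ∈ s, F i) u (∑ i ∈ s, a i) := by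
  classical
  constructor
  · intro v hv
    obtain ⟨i, hi, hv⟩ := Finset.mem_biUnion.1 (support_sum hv)
    exact (h i hi).1 v hv
  · rw [coeff_sum]
    exact Finset.sum_congr rfl fun i hi => (h i hi).2

lemma HasTopCoeff.prod {α : Type*} (s : Finset α) {F : α → MvPolynomial τ B} {u : α → τ →₀ ℕ}
    {a : α → B} (h : ∀ i ∈ s, HasTopCoeff (F i) (u i) (a i)) :
    HasTopCoeff (∏ i ∈ s, F i) (∑ i ∈ s, u i) (∏ i ∈ s, a i) := by
  classical
  induction s using Finset.induction_on with
  | empty =>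
    refine ⟨fun v hv => ?_, by simp⟩
    rw [Finset.prod_empty, ← C_1] at hv
    exact (Finset.mem_singleton.1 (support_monomial_subset hv)).le
  | insert i s hi ih =>
    rw [Finset.prod_insert hi, Finset.sum_insert hi, Finset.prod_insert hi]
    exact (h i (Finset.mem_insert_self _ _)).mul
      (ih fun j hj => h j (Finset.mem_insert_of_mem hj))

lemma hasTopCoeff_truncTrace (hp : 2 ≤ p) (N : τ → ℕ) (y : ι → B) (i : ι) (l : τ) :
    HasTopCoeff (truncTrace p N y i l) (Finsupp.single l (p ^ N l)) (y i ^ p ^ N l) := by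
  classical
  constructor
  · intro v hv
    obtain ⟨j, hj, rfl⟩ := mem_support_truncTrace p hv
    exact Finsupp.single_le_single.2 (Nat.pow_le_pow_right (by omega) hj)
  · rw [truncTrace, coeff_sum, Finset.sum_eq_single (N l)]
    · rw [C_mul_X_pow, coeff_monomial, if_pos rfl]
    · intro j hj hne
      rw [C_mul_X_pow, coeff_monomial, if_neg]
      intro h
      exact hne (Nat.pow_right_injective hp (Finsupp.single_injective l h))
    · intro h
      simp at h

lemma coeff_det_truncTrace [Fintype τ] [DecidableEq τ] (hp : 2 ≤ p) (N : τ → ℕ) (y : τ → B)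
    {e : τ →₀ ℕ} (he : ∀ l, e l = (p - 1) * p ^ N l) :
    coeff e ((Matrix.of fun i l => truncTrace p N y i l).det ^ (p - 1)) =
      (Matrix.of fun i l => y i ^ p ^ N l).det ^ (p - 1) := by
  have hdet : HasTopCoeff (Matrix.of fun i l => truncTrace p N y i l).det
      (∑ l, Finsupp.single l (p ^ N l)) (Matrix.of fun i l => y i ^ p ^ N l).det := by
    rw [Matrix.det_apply', Matrix.det_apply']
    refine HasTopCoeff.sum _ fun g _ => ?_
    have h1 : HasTopCoeff (((Equiv.Perm.sign g : ℤ) : MvPolynomial τ B)) 0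
        ((Equiv.Perm.sign g : ℤ) : B) := by
      have : (((Equiv.Perm.sign g : ℤ) : MvPolynomial τ B)) = C ((Equiv.Perm.sign g : ℤ) : B) := by
        simp
      rw [this]
      exact ⟨fun v hv => (Finset.mem_singleton.1 (support_monomial_subset hv)).le, coeff_zero_C _⟩
    simpa using h1.mul (HasTopCoeff.prod Finset.univ
      (fun l _ => hasTopCoeff_truncTrace p hp N y (g l) l))
  have := HasTopCoeff.prod (Finset.range (p - 1)) fun _ _ => hdet
  simp only [Finset.prod_const, Finset.sum_const, Finset.card_range] at this
  rw [← this.2]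
  congr 1
  ext l
  simp [he, Finsupp.single_apply]

lemma aeval_det_X {K A : Type*} [CommRing K] [CommRing A] [Algebra K A] [Fintype τ]
    [DecidableEq τ] (f : τ × τ → A) :
    aeval f (Matrix.of fun i l => (X (i, l) : MvPolynomial (τ × τ) K)).det =
      (Matrix.of fun i l => f (i, l)).det := by
  rw [AlgHom.map_det]
  congr 1
  ext i l
  simp

lemma prod_X_sub_C_algebraMap [Fact p.Prime] {σ K : Type*} [Field K] [DecidableEq K]
    [Algebra (ZMod p) K] (s : σ) :
    ∏ r ∈ Finset.univ.image (algebraMap (ZMod p) K), (X s - C r : MvPolynomial σ K) =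
      X s ^ p - X s := by
  rw [Finset.prod_image fun _ _ _ _ h => (algebraMap (ZMod p) K).injective h]
  have h : ∏ r : ZMod p, (Polynomial.X - Polynomial.C r) = Polynomial.X ^ p - Polynomial.X := by
    have hr := FiniteField.roots_X_pow_card_sub_X (ZMod p)
    have hdeg := FiniteField.X_pow_card_sub_X_natDegree_eq (ZMod p) (Fact.out : p.Prime).one_lt
    rw [ZMod.card] at hr
    have hmonic : (Polynomial.X ^ p - Polynomial.X : Polynomial (ZMod p)).Monic :=
      Polynomial.monic_X_pow_sub (by
        rw [Polynomial.degree_X]; exact_mod_cast (Fact.out : p.Prime).one_lt)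
    have h1 := Polynomial.prod_multiset_X_sub_C_of_monic_of_roots_card_eq hmonic
      (by rw [hr, hdeg]; simp [ZMod.card])
    rw [hr] at h1
    exact h1
  have h2 := congrArg (Polynomial.aeval (X s : MvPolynomial σ K)) h
  simpa [IsScalarTower.algebraMap_apply (ZMod p) K (MvPolynomial σ K),
    MvPolynomial.algebraMap_eq] using h2

/-- If a polynomial in matrix entries agrees with `det ^ (p - 1)` on matrices over the prime field,
then its value at the matrix of truncated traces has the corresponding coefficient. -/
lemma exists_coeff_aeval_truncTrace [Fintype τ] [DecidableEq τ] [Fact p.Prime] {K : Type*}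
    [Field K] [Algebra (ZMod p) K] [Algebra K B] [Nontrivial B] (b : MvPolynomial (τ × τ) K)
    (hb : ∀ φ : Matrix τ τ (ZMod p),
      eval (fun s => algebraMap (ZMod p) K (φ s.1 s.2)) b =
        algebraMap (ZMod p) K (φ.det ^ (p - 1))) :
    ∃ m, ∀ (N : τ → ℕ) (y : τ → B) (e : τ →₀ ℕ), (∀ l, m < N l) →
      (∀ l, e l = (p - 1) * p ^ N l) →
      coeff e (aeval (fun s : τ × τ => truncTrace p N y s.1 s.2) b) =
        (Matrix.of fun i l => y i ^ p ^ N l).det ^ (p - 1) := by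
  classical
  have hp := (Fact.out : p.Prime)
  have : CharP K p := charP_of_injective_algebraMap (algebraMap (ZMod p) K).injective p
  have : CharP B p := charP_of_injective_algebraMap (algebraMap K B).injective p
  let d : MvPolynomial (τ × τ) K := (Matrix.of fun i l => (X (i, l) : MvPolynomial (τ × τ) K)).det
  let S : τ × τ → Finset K := fun _ => Finset.univ.image (algebraMap (ZMod p) K)
  obtain ⟨h, -, hsum⟩ := combinatorial_nullstellensatz_exists_linearCombination S
    (fun i => by simp [S]) (b - d ^ (p - 1)) (by
      intro x hx
      have hx' : ∀ s, ∃ a : ZMod p, algebraMap (ZMod p) K a = x s := by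
        intro s; simpa [S] using hx s
      choose φ hφ using hx'
      let φ' : Matrix τ τ (ZMod p) := Matrix.of fun i l => φ (i, l)
      have hxe : x = fun s => algebraMap (ZMod p) K (φ' s.1 s.2) := by
        funext s; simp [φ', hφ]
      rw [hxe, map_sub, hb, map_pow (eval _), ← coe_aeval_eq_eval, RingHom.coe_coe, aeval_det_X,
        sub_eq_zero, map_pow, RingHom.map_det]
      rfl)
  choose m hm using fun s => exists_isPowSum_of_mem_support (τ := τ) (ι := τ) (B := B) p (h s)
  refine ⟨h.support.sup m, fun N y e hN he => ?_⟩
  rw [sub_eq_iff_eq_add, Finsupp.linearCombination_apply, Finsupp.sum] at hsum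
  rw [hsum, map_add, coeff_add, map_sum, coeff_sum, Finset.sum_eq_zero, zero_add, map_pow,
    aeval_det_X, coeff_det_truncTrace p hp.two_le N y he]
  intro s hs
  rw [smul_eq_mul, map_mul, prod_X_sub_C_algebraMap, map_sub, map_pow, aeval_X]
  exact coeff_mul_truncTrace_pow_sub p (hm s N y)
    (fun l => lt_of_le_of_lt (Finset.le_sup hs) (hN l)) y _ _ he

end Traces

section Functions

variable {p : ℕ} [Fact p.Prime]

lemma prime_dvd_card_dual_disjoint {U : Type*} [AddCommGroup U] [Module (ZMod p) U] [Finite U]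
    (hU : 2 ≤ Module.finrank (ZMod p) U) (W : Submodule (ZMod p) U) :
    p ∣ Nat.card {l : Module.Dual (ZMod p) U // Disjoint (LinearMap.ker l) W} := by
  classical
  have hfin : Finite (Module.Dual (ZMod p) U) := Module.finite_of_finite (ZMod p)
  have : Fintype {l : Module.Dual (ZMod p) U // Disjoint (LinearMap.ker l) W} :=
    Fintype.ofFinite _
  rw [Nat.card_eq_fintype_card]
  by_cases hW : W = ⊤
  · subst hW
    have : IsEmpty {l : Module.Dual (ZMod p) U // Disjoint (LinearMap.ker l) ⊤} := by
      refine ⟨fun l => ?_⟩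
      have h0 := disjoint_top.1 l.2
      have h1 := LinearMap.finrank_range_add_finrank_ker (l.1)
      have h2 := Submodule.finrank_le (LinearMap.range l.1)
      rw [h0, finrank_bot] at h1
      rw [Module.finrank_self] at h2
      omega
    rw [Fintype.card_eq_zero]
    exact dvd_zero p
  · obtain ⟨x, -, hx⟩ := SetLike.exists_of_lt (lt_top_iff_ne_top.2 hW)
    obtain ⟨μ, hμ, hle⟩ := Submodule.exists_le_ker_of_notMem hx
    have key : ∀ (m : Module.Dual (ZMod p) U), W ≤ LinearMap.ker m →
        ∀ l : Module.Dual (ZMod p) U, Disjoint (LinearMap.ker l) W →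
          Disjoint (LinearMap.ker (l + m)) W := by
      intro m hm l h
      rw [Submodule.disjoint_def] at h ⊢
      intro y hy hyW
      refine h y ?_ hyW
      have := hm hyW
      rw [LinearMap.mem_ker] at *
      simpa [this] using hy
    have hneg : W ≤ LinearMap.ker (-μ) := fun y hy => by
      have := hle hy
      rw [LinearMap.mem_ker] at *
      simp [this]
    let σ : Equiv.Perm {l : Module.Dual (ZMod p) U // Disjoint (LinearMap.ker l) W} :=
      { toFun := fun l => ⟨l.1 + μ, key μ hle l.1 l.2⟩
        invFun := fun l => ⟨l.1 + -μ, key (-μ) hneg l.1 l.2⟩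
        left_inv := fun l => Subtype.ext (by simp)
        right_inv := fun l => Subtype.ext (by simp) }
    have hσ : ∀ (k : ℕ) l, ((σ ^ k) l).1 = l.1 + (k : ZMod p) • μ := by
      intro k
      induction k with
      | zero => simp
      | succ k ih =>
        intro l
        rw [pow_succ', Equiv.Perm.mul_apply]
        change ((σ ^ k) l).1 + μ = _
        rw [ih, Nat.cast_succ, add_smul, one_smul, add_assoc]
    by_contra hdvd
    obtain ⟨l, hl⟩ := Equiv.Perm.exists_fixed_point_of_prime (n := 1) hdvd (σ := σ) (by
      ext1 l
      apply Subtype.ext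
      rw [hσ]
      simp)
    have h0 : l.1 + μ = l.1 := congrArg Subtype.val hl
    apply hμ
    rw [add_eq_left.1 h0]
    rfl

lemma exists_linearEquiv_map_eq {k V : Type*} [Field k] [AddCommGroup V] [Module k V]
    [FiniteDimensional k V] {U U' : Submodule k V}
    (h : Module.finrank k U = Module.finrank k U') : ∃ g : V ≃ₗ[k] V, U.map g.toLinearMap = U' := by
  let e := LinearEquiv.ofFinrankEq U U' h
  obtain ⟨g, hg⟩ := Submodule.exists_linearEquiv_restrict_eq e
  refine ⟨g, le_antisymm ?_ fun x hx => ?_⟩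
  · rintro _ ⟨x, hx, rfl⟩
    rw [LinearEquiv.coe_coe, ← hg ⟨x, hx⟩]
    exact (e ⟨x, hx⟩).2
  · exact ⟨e.symm ⟨x, hx⟩, (e.symm ⟨x, hx⟩).2, by rw [LinearEquiv.coe_coe, ← hg]; simp⟩

variable {τ K : Type*} [Fintype τ] [Field K] [Algebra (ZMod p) K]

/-- The function `φ ↦ f (φ w)` on square matrices over the prime field. -/
noncomputable def evalAt (f : MvPolynomial τ K) (w : τ → K) (φ : Matrix τ τ (ZMod p)) : K :=
  eval (φ.map (algebraMap (ZMod p) K) *ᵥ w) f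

lemma evalAt_mul (f : MvPolynomial τ K) (w : τ → K) (φ ψ : Matrix τ τ (ZMod p)) :
    evalAt f w (φ * ψ) = evalAt f (ψ.map (algebraMap (ZMod p) K) *ᵥ w) φ := by
  rw [evalAt, evalAt, Matrix.map_mul, mulVec_mulVec]

variable [DecidableEq τ]

open Classical in
/-- The indicator function of the matrices that are injective on `U`. -/
noncomputable def injIndicator (K : Type*) [Field K] (U : Submodule (ZMod p) (τ → ZMod p))
    (φ : Matrix τ τ (ZMod p)) : K :=
  if Disjoint U (LinearMap.ker (Matrix.toLin' φ)) then 1 else 0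

lemma injIndicator_mem_of_finrank_eq {f : MvPolynomial τ K}
    (hf : ∀ (g : GL τ (ZMod p)) w, evalAt f w g.1 = eval w f)
    {k : ℕ} (hk : ∀ (ψ : Matrix τ τ (ZMod p)) w, evalAt f w ψ ≠ 0 →
      k ≤ Module.finrank (ZMod p) (LinearMap.range (Matrix.toLin' ψ)))
    {ψ₀ : Matrix τ τ (ZMod p)} {z : τ → K} (hψ₀ : evalAt f z ψ₀ ≠ 0)
    (hψk : Module.finrank (ZMod p) (LinearMap.range (Matrix.toLin' ψ₀)) = k)
    {U : Submodule (ZMod p) (τ → ZMod p)} (hU : Module.finrank (ZMod p) U = k) :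
    injIndicator K U ∈ Submodule.span K (Set.range (evalAt (p := p) f)) := by
  classical
  have hlin : ∀ (g : (τ → ZMod p) ≃ₗ[ZMod p] (τ → ZMod p)) (ψ : Matrix τ τ (ZMod p)),
      evalAt f z (LinearMap.toMatrix' g.toLinearMap * ψ) = evalAt f z ψ := by
    intro g ψ
    rw [evalAt_mul]
    have hu : IsUnit (LinearMap.toMatrix' g.toLinearMap) := by
      refine ⟨⟨LinearMap.toMatrix' g.toLinearMap, LinearMap.toMatrix' g.symm.toLinearMap,
        ?_, ?_⟩, rfl⟩ <;> rw [← LinearMap.toMatrix'_comp] <;> simp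
    obtain ⟨u, hu⟩ := hu
    rw [← hu, hf u]
    rfl
  obtain ⟨h, hh⟩ := exists_linearEquiv_map_eq (hψk.trans hU.symm)
  obtain ⟨ψ, hψ, hs⟩ : ∃ ψ : Matrix τ τ (ZMod p),
      LinearMap.range (Matrix.toLin' ψ) = U ∧ evalAt f z ψ ≠ 0 := by
    refine ⟨LinearMap.toMatrix' h.toLinearMap * ψ₀, ?_, by rwa [hlin]⟩
    rw [← hh, Matrix.toLin'_mul, Matrix.toLin'_toMatrix', LinearMap.range_comp]
  have key : injIndicator K U = (evalAt f z ψ)⁻¹ •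
      evalAt (p := p) f (ψ.map (algebraMap (ZMod p) K) *ᵥ z) := by
    funext φ
    rw [Pi.smul_apply, ← evalAt_mul, injIndicator, smul_eq_mul]
    have hcomp : Matrix.toLin' (φ * ψ) = Matrix.toLin' φ ∘ₗ Matrix.toLin' ψ :=
      Matrix.toLin'_mul _ _
    split_ifs with hd
    · obtain ⟨g, hg⟩ := Submodule.exists_linearEquiv_restrict_eq
        (LinearEquiv.ofInjective ((Matrix.toLin' φ).domRestrict U) (by
          rw [← LinearMap.ker_eq_bot, LinearMap.ker_eq_bot']
          rintro ⟨x, hx⟩ hx0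
          exact Subtype.ext (Submodule.disjoint_def.1 hd x hx hx0)))
      have : φ * ψ = LinearMap.toMatrix' g.toLinearMap * ψ := by
        apply Matrix.toLin'.injective
        rw [Matrix.toLin'_mul, Matrix.toLin'_mul, Matrix.toLin'_toMatrix']
        refine LinearMap.ext fun x => ?_
        exact hg ⟨Matrix.toLin' ψ x, hψ ▸ LinearMap.mem_range_self _ x⟩
      rw [this, hlin, inv_mul_cancel₀ hs]
    · rw [eq_comm, mul_eq_zero, inv_eq_zero]
      refine Or.inr (by_contra fun hne => hd ?_)
      have h1 := hk _ _ hne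
      rw [hcomp, LinearMap.range_comp, hψ] at h1
      have h2 := LinearMap.finrank_range_add_finrank_ker ((Matrix.toLin' φ).domRestrict U)
      rw [LinearMap.range_domRestrict, hU] at h2
      have h3 : LinearMap.ker ((Matrix.toLin' φ).domRestrict U) = ⊥ :=
        Submodule.finrank_eq_zero.1 (by omega)
      rw [Submodule.disjoint_def]
      intro x hx hx0
      have h4 : (⟨x, hx⟩ : U) ∈ LinearMap.ker ((Matrix.toLin' φ).domRestrict U) := hx0
      rw [h3] at h4
      exact congrArg Subtype.val ((Submodule.mem_bot _).1 h4)
  rw [key]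
  exact Submodule.smul_mem _ _ (Submodule.subset_span ⟨_, rfl⟩)

lemma sum_injIndicator_ker {U : Submodule (ZMod p) (τ → ZMod p)}
    [Fintype (Module.Dual (ZMod p) U)] (hU : 2 ≤ Module.finrank (ZMod p) U) :
    ∑ l : Module.Dual (ZMod p) U, injIndicator K ((LinearMap.ker l).map U.subtype) = 0 := by
  classical
  funext φ
  have : CharP K p := charP_of_injective_algebraMap (algebraMap (ZMod p) K).injective p
  have h := prime_dvd_card_dual_disjoint hU
    ((LinearMap.ker (Matrix.toLin' φ)).comap U.subtype)
  rw [Nat.card_eq_fintype_card, Fintype.card_subtype, ← CharP.cast_eq_zero_iff K p] at h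
  rw [Finset.sum_apply, Pi.zero_apply, ← h, Finset.cast_card, Finset.sum_filter]
  refine Finset.sum_congr rfl fun l _ => ?_
  rw [injIndicator, Submodule.disjoint_def, Submodule.disjoint_def]
  congr 1
  simp only [eq_iff_iff]
  constructor
  · intro h x hx hx'
    exact Subtype.ext (h x ⟨x, hx, rfl⟩ hx')
  · rintro h _ ⟨x, hx, rfl⟩ hx'
    rw [h x hx hx', map_zero]

/-- The span of the translates of a nonzero invariant polynomial without constant term contains
the function `det ^ (p - 1)`. -/
lemma det_pow_mem_span_evalAt [Infinite K] {f : MvPolynomial τ K} (hf0 : f ≠ 0)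
    (hf : ∀ (g : GL τ (ZMod p)) w, evalAt f w g.1 = eval w f) (hc : constantCoeff f = 0) :
    (fun φ : Matrix τ τ (ZMod p) => algebraMap (ZMod p) K (φ.det ^ (p - 1))) ∈
      Submodule.span K (Set.range (evalAt (p := p) f)) := by
  classical
  have hex : ∃ k, ∃ (ψ : Matrix τ τ (ZMod p)) (z : τ → K), evalAt f z ψ ≠ 0 ∧
      Module.finrank (ZMod p) (LinearMap.range (Matrix.toLin' ψ)) = k := by
    obtain ⟨z, hz⟩ : ∃ z, eval z f ≠ 0 := by
      by_contra! h
      exact hf0 (MvPolynomial.funext fun z => by rw [h, map_zero])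
    exact ⟨_, 1, z, by simpa [evalAt] using hz, rfl⟩
  obtain ⟨ψ₀, z, hψ₀, hψk⟩ := Nat.find_spec hex
  set k := Nat.find hex with hkdef
  have hk : ∀ (ψ : Matrix τ τ (ZMod p)) w, evalAt f w ψ ≠ 0 →
      k ≤ Module.finrank (ZMod p) (LinearMap.range (Matrix.toLin' ψ)) :=
    fun ψ w h => Nat.find_min' hex ⟨ψ, w, h, rfl⟩
  have hk0 : 0 < k := by
    rw [Nat.pos_iff_ne_zero]
    intro h0
    rw [h0, Submodule.finrank_eq_zero, LinearMap.range_eq_bot] at hψk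
    have : ψ₀ = 0 := Matrix.toLin'.injective (by rw [hψk, map_zero])
    apply hψ₀
    rw [this, evalAt]
    simp [← hc, constantCoeff_eq, eval_zero]
  have main : ∀ m, k ≤ m → ∀ U : Submodule (ZMod p) (τ → ZMod p),
      Module.finrank (ZMod p) U = m →
      injIndicator K U ∈ Submodule.span K (Set.range (evalAt (p := p) f)) := by
    intro m hm
    induction m, hm using Nat.le_induction with
    | base => exact fun U hU => injIndicator_mem_of_finrank_eq hf hk hψ₀ hψk hU
    | succ m hm ih =>
      intro U hU
      have : Finite (Module.Dual (ZMod p) U) := Module.finite_of_finite (ZMod p)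
      have := Fintype.ofFinite (Module.Dual (ZMod p) U)
      have hsum := sum_injIndicator_ker (K := K) (U := U) (by omega)
      rw [← Finset.add_sum_erase _ _ (Finset.mem_univ 0), LinearMap.ker_zero, Submodule.map_top,
        Submodule.range_subtype] at hsum
      rw [eq_neg_of_add_eq_zero_left hsum]
      refine Submodule.neg_mem _ (Submodule.sum_mem _ fun l hl => ih _ ?_)
      have h1 := LinearMap.finrank_range_add_finrank_ker l
      rw [LinearMap.range_eq_top.2 (LinearMap.surjective (Finset.ne_of_mem_erase hl)), finrank_top,
        Module.finrank_self, hU] at h1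
      rw [Submodule.finrank_map_subtype_eq]
      omega
  have hle : k ≤ Module.finrank (ZMod p) (⊤ : Submodule (ZMod p) (τ → ZMod p)) := by
    rw [← hψk]
    exact Submodule.finrank_mono le_top
  convert main _ hle ⊤ rfl using 1
  funext φ
  rw [injIndicator, top_disjoint]
  have hdet := LinearMap.det_eq_zero_iff_ker_ne_bot (f := Matrix.toLin' φ)
  rw [LinearMap.det_toLin'] at hdet
  split_ifs with h
  · rw [ZMod.pow_card_sub_one_eq_one fun h0 => hdet.1 h0 h, map_one]
  · rw [hdet.2 h, zero_pow (Nat.sub_ne_zero_of_lt (Fact.out : p.Prime).one_lt), map_zero]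

end Functions

section Extraction

variable {τ K : Type*} [Fintype τ] (p : ℕ) [Fact p.Prime]

lemma det_X_pow_ne_zero [DecidableEq τ] {R : Type*} [CommRing R] [Nontrivial R] {e : τ → ℕ}
    (he : Function.Injective e) :
    (Matrix.of fun i l => (X i : MvPolynomial τ R) ^ e l).det ≠ 0 := by
  intro h
  have h1 := congrArg (coeff (Finsupp.equivFunOnFinite.symm e)) h
  rw [Matrix.det_apply', coeff_sum, Finset.sum_eq_single 1] at h1
  · have : ∏ l, (X l : MvPolynomial τ R) ^ e l =
        monomial (Finsupp.equivFunOnFinite.symm e) 1 := by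
      rw [monomial_eq, C_1, one_mul, Finsupp.prod_fintype _ _ (by simp)]
      rfl
    simp [this] at h1
  · intro g _ hg
    have hc : (((Equiv.Perm.sign g : ℤ) : MvPolynomial τ R)) = C ((Equiv.Perm.sign g : ℤ) : R) := by
      simp
    have : ∏ l, (X (g l) : MvPolynomial τ R) ^ e l =
        monomial (Finsupp.equivFunOnFinite.symm (e ∘ g.symm)) 1 := by
      rw [monomial_eq, C_1, one_mul, Finsupp.prod_fintype _ _ (by simp),
        ← Equiv.prod_comp g fun x => (X x : MvPolynomial τ R) ^ _]
      simp
    simp only [Matrix.of_apply]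
    rw [hc, this, coeff_C_mul, coeff_monomial, if_neg, mul_zero]
    intro h2
    apply hg
    ext1 l
    have h3 := DFunLike.congr_fun h2 (g l)
    simp only [Finsupp.equivFunOnFinite_symm_apply_apply, Function.comp_apply,
      Equiv.symm_apply_apply] at h3
    exact (he h3).symm
  · simp

variable [Field K]

/-- The polynomial in matrix entries whose value at `φ` is `f (φ w)`. -/
noncomputable def matrixEval (f : MvPolynomial τ K) (w : τ → K) : MvPolynomial (τ × τ) K :=
  aeval (fun i => ∑ l, C (w l) * X (i, l)) f

lemma eval_matrixEval [Algebra (ZMod p) K] (f : MvPolynomial τ K) (w : τ → K)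
    (φ : Matrix τ τ (ZMod p)) :
    eval (fun s => algebraMap (ZMod p) K (φ s.1 s.2)) (matrixEval f w) = evalAt f w φ := by
  rw [matrixEval, evalAt, ← coe_aeval_eq_eval, RingHom.coe_coe, ← AlgHom.comp_apply, comp_aeval,
    ← coe_aeval_eq_eval, RingHom.coe_coe]
  congr 2
  funext i
  simp [Matrix.mulVec, dotProduct, mul_comm]

lemma coeff_aeval_matrixEval_mem [CharP K p] [IsAlgClosed K]
    (W : Submodule K (MvPolynomial τ K))
    (hW : ∀ a c : K, a ≠ 0 → ∀ g ∈ W,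
      aeval (fun i => C a * X i + C c * X i ^ p : τ → MvPolynomial τ K) g ∈ W)
    {f : MvPolynomial τ K} (hf : f ∈ W) (hc : constantCoeff f = 0) (N : τ → ℕ) (w : τ → K)
    (e : τ →₀ ℕ) :
    coeff e (aeval (fun s : τ × τ => truncTrace p N (X : τ → MvPolynomial τ K) s.1 s.2)
      (matrixEval f w)) ∈ W := by
  classical
  rw [matrixEval, ← AlgHom.comp_apply, comp_aeval]
  by_cases hw : w = 0
  · subst hw
    have h0 : ∀ q : MvPolynomial τ K,
        aeval (fun _ : τ => (0 : MvPolynomial τ (MvPolynomial τ K))) q =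
          algebraMap K _ (constantCoeff q) := by
      intro q
      simp [aeval_zero']
    simp [h0, hc]
  let g : MvPolynomial τ K := ∑ l, C (w l) * X l
  have hg : g ≠ 0 := by
    intro h
    apply hw
    funext l
    have := congrArg (coeff (Finsupp.single l 1)) h
    simpa [g, coeff_sum, coeff_C_mul, coeff_X, Finsupp.single_left_inj] using this
  refine coeff_mem_of_eval_mem W _ g hg (fun β hβ => ?_) e
  let M := Finset.univ.sup N
  let a : ℕ → K := fun j => ∑ l, if j ≤ N l then w l * β l ^ p ^ j else 0
  have ha0 : a 0 ≠ 0 := by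
    simpa [a, g] using hβ
  convert additiveSubst_mem p W hW M a ha0 hf using 1
  let ev : MvPolynomial τ (MvPolynomial τ K) →ₐ[K] MvPolynomial τ K :=
    (aeval fun l => (C (β l) : MvPolynomial τ K) :
      MvPolynomial τ (MvPolynomial τ K) →ₐ[MvPolynomial τ K] MvPolynomial τ K).restrictScalars K
  change ev _ = _
  rw [← AlgHom.comp_apply, comp_aeval, additiveSubst]
  congr 2
  funext i
  have : ∀ l, ∑ j ∈ Finset.range (N l + 1), (X i * C (β l) : MvPolynomial τ K) ^ p ^ j =
      ∑ j ∈ Finset.range (M + 1),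
        if j ≤ N l then (X i * C (β l) : MvPolynomial τ K) ^ p ^ j else 0 := by
    intro l
    have hl : N l ≤ M := Finset.le_sup (Finset.mem_univ l)
    rw [← Finset.sum_filter]
    refine Finset.sum_congr ?_ fun _ _ => rfl
    ext j
    simp only [Finset.mem_range, Finset.mem_filter]
    omega
  have hevX : ∀ l, ev (X l) = C (β l) := fun l => aeval_X _ l
  have hevC : ∀ q, ev (C q) = q := fun q => aeval_C _ q
  simp only [map_sum, map_mul, algHom_C, aeval_X, truncTrace, map_pow, AlgHom.commutes, hevX,
    hevC, algebraMap_eq]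
  simp only [this, Finset.mul_sum, a]
  rw [Finset.sum_comm]
  refine Finset.sum_congr rfl fun j _ => ?_
  rw [map_sum, Finset.sum_mul]
  refine Finset.sum_congr rfl fun l _ => ?_
  split_ifs
  · simp only [map_mul, map_pow]
    ring
  · simp

/-- A subspace of polynomials closed under the substitutions `X ↦ a X + c X ^ p` and containing
a nonzero invariant without constant term contains powers of all high enough Moore determinants. -/
lemma exists_det_pow_mem [DecidableEq τ] [Algebra (ZMod p) K] [CharP K p] [IsAlgClosed K]
    (W : Submodule K (MvPolynomial τ K))
    (hW : ∀ a c : K, a ≠ 0 → ∀ g ∈ W,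
      aeval (fun i => C a * X i + C c * X i ^ p : τ → MvPolynomial τ K) g ∈ W)
    {f : MvPolynomial τ K} (hf : f ∈ W) (hf0 : f ≠ 0) (hc : constantCoeff f = 0)
    (hinv : ∀ (g : GL τ (ZMod p)) w, evalAt f w g.1 = eval w f) :
    ∃ m, ∀ N : τ → ℕ, (∀ l, m < N l) →
      (Matrix.of fun i l => (X i : MvPolynomial τ K) ^ p ^ N l).det ^ (p - 1) ∈ W := by
  have hδ := det_pow_mem_span_evalAt hf0 hinv hc
  let L : MvPolynomial (τ × τ) K →ₗ[K] (Matrix τ τ (ZMod p) → K) :=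
    LinearMap.pi fun φ => (aeval fun s => algebraMap (ZMod p) K (φ s.1 s.2)).toLinearMap
  have hL : Set.range (evalAt (p := p) f) = L '' Set.range (matrixEval f) := by
    rw [← Set.range_comp]
    congr 1
    funext w φ
    rw [← eval_matrixEval, ← coe_aeval_eq_eval]
    rfl
  rw [hL, ← Submodule.map_span] at hδ
  obtain ⟨b, hb, hbL⟩ := hδ
  obtain ⟨m, hm⟩ := exists_coeff_aeval_truncTrace (B := MvPolynomial τ K) p b (fun φ => by
    have := congrFun hbL φ
    rw [← coe_aeval_eq_eval]
    exact this)
  refine ⟨m, fun N hN => ?_⟩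
  let e : τ →₀ ℕ := Finsupp.equivFunOnFinite.symm fun l => (p - 1) * p ^ N l
  rw [← hm N X e hN fun l => rfl]
  clear hm hbL
  induction hb using Submodule.span_induction with
  | mem x hx =>
    obtain ⟨w, rfl⟩ := hx
    exact coeff_aeval_matrixEval_mem p W hW hf hc N w e
  | zero => simp
  | add x y _ _ hx hy =>
    rw [map_add, coeff_add]
    exact W.add_mem hx hy
  | smul c x _ hx =>
    rw [map_smul, ← algebraMap_smul (MvPolynomial τ K) c, coeff_smul, algebraMap_smul]
    exact W.smul_mem c hx

end Extraction

section PolynomialSteenrod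

variable {τ F : Type*} [Field F] (p : ℕ)

/-- The total reduced power on polynomials. -/
noncomputable def totalPower : MvPolynomial τ F →ₐ[F] Polynomial (MvPolynomial τ F) :=
  aeval fun i => Polynomial.C (X i) + Polynomial.C (X i ^ p) * Polynomial.X

variable {p} in
lemma isHomogeneous_coeff_totalPower_mul {f g : MvPolynomial τ F} {d e : ℕ}
    (hf : ∀ k, ((totalPower p f).coeff k).IsHomogeneous (d + k * (p - 1)))
    (hg : ∀ k, ((totalPower p g).coeff k).IsHomogeneous (e + k * (p - 1))) (k : ℕ) :
    ((totalPower p (f * g)).coeff k).IsHomogeneous (d + e + k * (p - 1)) := by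
  rw [map_mul, Polynomial.coeff_mul]
  refine IsHomogeneous.sum _ _ _ fun x hx => ?_
  have : x.1 + x.2 = k := Finset.HasAntidiagonal.mem_antidiagonal.1 hx
  convert (hf x.1).mul (hg x.2) using 1
  rw [← this]
  ring

lemma isHomogeneous_coeff_totalPower_C (c : F) (k : ℕ) :
    ((totalPower p (C c : MvPolynomial τ F)).coeff k).IsHomogeneous (0 + k * (p - 1)) := by
  rw [totalPower, aeval_C, IsScalarTower.algebraMap_apply F (MvPolynomial τ F),
    Polynomial.algebraMap_eq, Polynomial.coeff_C]
  split_ifs with h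
  · subst h
    simpa using isHomogeneous_C τ c
  · exact isHomogeneous_zero _ _ _

variable {p} in
lemma isHomogeneous_coeff_totalPower_X (hp : 1 ≤ p) (i : τ) (k : ℕ) :
    ((totalPower p (X i : MvPolynomial τ F)).coeff k).IsHomogeneous (1 + k * (p - 1)) := by
  rw [totalPower, aeval_X, Polynomial.coeff_add, Polynomial.coeff_C, Polynomial.coeff_C_mul,
    Polynomial.coeff_X]
  rcases k with - | k
  · simpa using isHomogeneous_X F i
  rcases k with - | k
  · simpa [Nat.add_sub_cancel' hp] using isHomogeneous_X_pow (R := F) i p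
  · simpa using isHomogeneous_zero _ _ _

variable {p} in
lemma isHomogeneous_coeff_totalPower (hp : 1 ≤ p) {f : MvPolynomial τ F} {d : ℕ}
    (hf : f.IsHomogeneous d) (k : ℕ) :
    ((totalPower p f).coeff k).IsHomogeneous (d + k * (p - 1)) := by
  have hmon : ∀ (u : τ →₀ ℕ) (c : F) (k : ℕ),
      ((totalPower p (monomial u c)).coeff k).IsHomogeneous (u.degree + k * (p - 1)) := by
    intro u
    induction u using Finsupp.induction_linear with
    | zero => simpa using isHomogeneous_coeff_totalPower_C (τ := τ) p
    | add u v hu hv =>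
      intro c k
      rw [← mul_one c, ← monomial_mul, map_add]
      exact isHomogeneous_coeff_totalPower_mul (hu c) (hv 1) k
    | single i m =>
      intro c
      rw [← C_mul_X_pow_eq_monomial, Finsupp.degree_single]
      induction m with
      | zero => simpa using isHomogeneous_coeff_totalPower_C (τ := τ) p c
      | succ m ih =>
        rw [pow_succ, ← mul_assoc]
        exact isHomogeneous_coeff_totalPower_mul ih (isHomogeneous_coeff_totalPower_X hp i)
  rw [f.as_sum, map_sum, Polynomial.finsetSum_coeff]
  refine IsHomogeneous.sum _ _ _ fun u hu => ?_
  have : u.degree = d := by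
    by_contra h
    exact mem_support_iff.1 hu (hf.coeff_eq_zero h)
  rw [← this]
  exact hmon u _ k

lemma aeval_add_C_mul_X_pow_map {K : Type*} [Field K] [Algebra F K] (t : K)
    (f : MvPolynomial τ F) :
    aeval (fun i => X i + C t * X i ^ p : τ → MvPolynomial τ K) (map (algebraMap F K) f) =
      (totalPower p f).eval₂ (map (algebraMap F K)) (C t) := by
  induction f using MvPolynomial.induction_on with
  | C a =>
    rw [map_C, algHom_C, totalPower, algHom_C,
      IsScalarTower.algebraMap_apply F (MvPolynomial τ F) (Polynomial (MvPolynomial τ F)),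
      Polynomial.algebraMap_eq, Polynomial.eval₂_C, algebraMap_eq, algebraMap_eq, map_C]
  | add f g hf hg => rw [map_add, map_add, map_add, Polynomial.eval₂_add, hf, hg]
  | mul_X f i hf =>
    have hX : totalPower (F := F) p (X i : MvPolynomial τ F) =
        Polynomial.C (X i) + Polynomial.C (X i ^ p) * Polynomial.X := aeval_X _ i
    rw [map_mul, map_mul, map_mul, Polynomial.eval₂_mul, hf, hX, map_X, aeval_X,
      Polynomial.eval₂_add, Polynomial.eval₂_mul, Polynomial.eval₂_C, Polynomial.eval₂_C,
      Polynomial.eval₂_X, map_pow, map_X, mul_comm (C t)]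

lemma aeval_mul_of_isHomogeneous {K B : Type*} [CommRing K] [CommRing B] [Algebra K B]
    {f : MvPolynomial τ K} {d : ℕ} (hf : f.IsHomogeneous d) (b : B) (v : τ → B) :
    aeval (fun i => b * v i) f = b ^ d * aeval v f := by
  rw [f.as_sum, map_sum, map_sum, Finset.mul_sum]
  refine Finset.sum_congr rfl fun u hu => ?_
  have : u.degree = d := by
    by_contra h
    exact mem_support_iff.1 hu (hf.coeff_eq_zero h)
  have hb : ∏ a ∈ u.support, b ^ u a = b ^ d := by
    rw [← this]
    exact Finset.prod_pow_eq_pow_sum _ _ _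
  rw [aeval_monomial, aeval_monomial, Finsupp.prod, Finsupp.prod, ← hb]
  simp_rw [mul_pow]
  rw [Finset.prod_mul_distrib]
  ring

end PolynomialSteenrod

/-- A set of homogeneous polynomials closed under the reduced powers and containing a nonzero
invariant of positive degree spans a space which contains powers of all high enough Moore
determinants. -/
lemma exists_det_pow_mem_span {τ : Type*} [Fintype τ] [DecidableEq τ] (p : ℕ) [Fact p.Prime]
    (s : Set (MvPolynomial τ (ZMod p))) (hs : ∀ f ∈ s, ∃ d, f.IsHomogeneous d)
    (hP : ∀ f ∈ s, ∀ k, (totalPower p f).coeff k ∈ s)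
    {f : MvPolynomial τ (ZMod p)} (hf : f ∈ s) (hf0 : f ≠ 0) (hc : constantCoeff f = 0)
    (hinv : ∀ g : GL τ (ZMod p), aeval (fun i => ∑ j, C (g.1 j i) * X j) f = f) :
    ∃ m, ∀ N : τ → ℕ, (∀ l, m < N l) →
      (Matrix.of fun i l => (X i : MvPolynomial τ (ZMod p)) ^ p ^ N l).det ^ (p - 1) ∈
        Submodule.span (ZMod p) s := by
  let K := AlgebraicClosure (ZMod p)
  let ψ : MvPolynomial τ (ZMod p) →+* MvPolynomial τ K := map (algebraMap (ZMod p) K)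
  have : CharP K p := charP_of_injective_algebraMap (algebraMap (ZMod p) K).injective p
  have hmem : ∀ g ∈ s, ψ g ∈ Submodule.span K (ψ '' s) := fun g hg =>
    Submodule.subset_span ⟨g, hg, rfl⟩
  have hW : ∀ a c : K, a ≠ 0 → ∀ g ∈ Submodule.span K (ψ '' s),
      aeval (fun i => C a * X i + C c * X i ^ p : τ → MvPolynomial τ K) g ∈
        Submodule.span K (ψ '' s) := by
    intro a c ha g hg
    induction hg using Submodule.span_induction with
    | mem g hg =>
      obtain ⟨g, hg, rfl⟩ := hg
      obtain ⟨d, hd⟩ := hs g hg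
      have h1 : (fun i => C a * X i + C c * X i ^ p : τ → MvPolynomial τ K) =
          fun i => C a * (X i + C (c / a) * X i ^ p) := by
        funext i
        rw [mul_add, ← mul_assoc, ← C_mul, mul_div_cancel₀ _ ha]
      rw [h1, aeval_mul_of_isHomogeneous (hd.map _), aeval_add_C_mul_X_pow_map, ← C_pow,
        ← smul_eq_C_mul, Polynomial.eval₂_eq_sum_range]
      refine Submodule.smul_mem _ _ (Submodule.sum_mem _ fun k _ => ?_)
      rw [← C_pow, mul_comm, ← smul_eq_C_mul]
      exact Submodule.smul_mem _ _ (hmem _ (hP g hg k))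
    | zero => simp
    | add x y _ _ hx hy => rw [map_add]; exact Submodule.add_mem _ hx hy
    | smul c x _ hx => rw [map_smul]; exact Submodule.smul_mem _ _ hx
  obtain ⟨m, hm⟩ := exists_det_pow_mem p _ hW (hmem f hf)
    ((map_ne_zero_iff ψ (map_injective _ (algebraMap (ZMod p) K).injective)).2 hf0)
    (by rw [constantCoeff_map, hc, map_zero]) (by
      intro g w
      have h1 := congrArg (aeval w) (hinv (⟨g.1ᵀ, (g⁻¹).1ᵀ, by
        rw [← Matrix.transpose_mul, ← Units.val_mul, inv_mul_cancel, Units.val_one,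
          Matrix.transpose_one], by
        rw [← Matrix.transpose_mul, ← Units.val_mul, mul_inv_cancel, Units.val_one,
          Matrix.transpose_one]⟩ : GL τ (ZMod p)))
      rw [← AlgHom.comp_apply, comp_aeval] at h1
      rw [evalAt, eval_map, eval_map, ← aeval_def, ← aeval_def, ← h1]
      congr 2
      funext i
      simp [Matrix.mulVec, dotProduct])
  refine ⟨m, fun N hN => mem_of_map_mem_span (K := K) _ ?_⟩
  have h1 := hm N hN
  refine Submodule.span_mono (Set.image_mono Submodule.subset_span) ?_
  convert h1 using 1
  rw [map_pow, RingHom.map_det]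
  congr 2
  ext1 i l
  simp

section ExteriorFactor

variable {p n : ℕ} [Fact p.Prime]

lemma contractLeft_mem_range_pow (d : Module.Dual (ZMod p) (Fin n → ZMod p)) (i : ℕ)
    {a : ExteriorAlgebra (ZMod p) (Fin n → ZMod p)}
    (ha : a ∈ (LinearMap.range (ExteriorAlgebra.ι (ZMod p) :
      (Fin n → ZMod p) →ₗ[ZMod p] ExteriorAlgebra (ZMod p) (Fin n → ZMod p))) ^ (i + 1)) :
    CliffordAlgebra.contractLeft d a ∈ (LinearMap.range (ExteriorAlgebra.ι (ZMod p) :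
      (Fin n → ZMod p) →ₗ[ZMod p] ExteriorAlgebra (ZMod p) (Fin n → ZMod p))) ^ i := by
  induction i generalizing a with
  | zero =>
    rw [zero_add, pow_one] at ha
    obtain ⟨v, rfl⟩ := ha
    rw [pow_zero, ExteriorAlgebra.ι, CliffordAlgebra.contractLeft_ι]
    exact Submodule.algebraMap_mem _
  | succ i ih =>
    rw [pow_succ'] at ha
    induction ha using Submodule.mul_induction_on' with
    | mem_mul_mem x hx y hy =>
      obtain ⟨v, rfl⟩ := hx
      rw [ExteriorAlgebra.ι, CliffordAlgebra.contractLeft_ι_mul]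
      refine Submodule.sub_mem _ (Submodule.smul_mem _ _ hy) ?_
      rw [pow_succ']
      exact Submodule.mul_mem_mul ⟨v, rfl⟩ (ih hy)
    | add x _ y _ hx hy => rw [map_add]; exact Submodule.add_mem _ hx hy

lemma algebraMapInv_eq_zero_of_mem_range_pow (i : ℕ)
    {a : ExteriorAlgebra (ZMod p) (Fin n → ZMod p)}
    (ha : a ∈ (LinearMap.range (ExteriorAlgebra.ι (ZMod p) :
      (Fin n → ZMod p) →ₗ[ZMod p] ExteriorAlgebra (ZMod p) (Fin n → ZMod p))) ^ (i + 1)) :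
    ExteriorAlgebra.algebraMapInv a = 0 := by
  rw [pow_succ'] at ha
  induction ha using Submodule.mul_induction_on' with
  | mem_mul_mem x hx y hy =>
    obtain ⟨v, rfl⟩ := hx
    rw [map_mul]
    simp [ExteriorAlgebra.algebraMapInv]
  | add x _ y _ hx hy => rw [map_add, hx, hy, add_zero]

/-- Contraction with the `i`-th coordinate on the exterior factor. -/
noncomputable def contract (p n : ℕ) (i : Fin n) : ExtA p n →ₗ[ZMod p] ExtA p n :=
  LinearMap.rTensor _ (CliffordAlgebra.contractLeft (LinearMap.proj i))

lemma contract_tmul (i : Fin n) (a : ExteriorAlgebra (ZMod p) (Fin n → ZMod p))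
    (f : MvPolynomial (Fin n) (ZMod p)) :
    contract p n i (a ⊗ₜ f) = CliffordAlgebra.contractLeft (LinearMap.proj i) a ⊗ₜ f := rfl

/-- The retraction of `A_n` onto its polynomial factor. -/
noncomputable def polyRetract (p n : ℕ) : ExtA p n →ₗ[ZMod p] MvPolynomial (Fin n) (ZMod p) :=
  (TensorProduct.lid (ZMod p) _).toLinearMap ∘ₗ
    LinearMap.rTensor _ (ExteriorAlgebra.algebraMapInv (R := ZMod p)).toLinearMap

lemma polyRetract_tmul (a : ExteriorAlgebra (ZMod p) (Fin n → ZMod p))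
    (f : MvPolynomial (Fin n) (ZMod p)) :
    polyRetract p n (a ⊗ₜ f) = ExteriorAlgebra.algebraMapInv a • f := rfl

lemma polyRetract_one_tmul (f : MvPolynomial (Fin n) (ZMod p)) :
    polyRetract p n (1 ⊗ₜ f) = f := by
  rw [polyRetract_tmul, map_one, one_smul]

lemma exists_projection_of_contract_eq_zero (L : List (Fin n)) :
    ∃ T : ExteriorAlgebra (ZMod p) (Fin n → ZMod p) →ₗ[ZMod p]
        ExteriorAlgebra (ZMod p) (Fin n → ZMod p),
      T 1 = 1 ∧ (∀ j ∈ L, ∀ b,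
        T (ExteriorAlgebra.ι (ZMod p) (Pi.single j 1 : Fin n → ZMod p) * b) = 0) ∧
      ∀ v : ExtA p n, (∀ i, contract p n i v = 0) → LinearMap.rTensor _ T v = v := by
  induction L with
  | nil => exact ⟨LinearMap.id, rfl, by simp, fun v _ => by simp⟩
  | cons i L ih =>
    obtain ⟨T, h1, hL, hv⟩ := ih
    let q : ExteriorAlgebra (ZMod p) (Fin n → ZMod p) →ₗ[ZMod p]
        ExteriorAlgebra (ZMod p) (Fin n → ZMod p) :=
      LinearMap.mulLeft (ZMod p) (ExteriorAlgebra.ι (ZMod p) (Pi.single i 1)) ∘ₗ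
        CliffordAlgebra.contractLeft (LinearMap.proj i)
    have hq : ∀ j b, q (ExteriorAlgebra.ι (ZMod p) (Pi.single j 1) * b) =
        ExteriorAlgebra.ι (ZMod p) (Pi.single i 1) * ((Pi.single j 1 : Fin n → ZMod p) i • b -
          ExteriorAlgebra.ι (ZMod p) (Pi.single j 1) *
            CliffordAlgebra.contractLeft (LinearMap.proj i) b) := fun j b =>
      congrArg _ (CliffordAlgebra.contractLeft_ι_mul _ _ _)
    refine ⟨T ∘ₗ (LinearMap.id - q), ?_, ?_, ?_⟩
    · have : q 1 = 0 := by simp [q]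
      simp [this, h1]
    · intro j hj b
      rw [LinearMap.comp_apply, LinearMap.sub_apply, LinearMap.id_apply, hq]
      by_cases hij : j = i
      · subst hij
        rw [Pi.single_eq_same, one_smul, mul_sub, ← mul_assoc (ExteriorAlgebra.ι _ _),
          ExteriorAlgebra.ι_sq_zero, zero_mul, sub_zero, sub_self, map_zero]
      · have hanti := ExteriorAlgebra.ι_add_mul_swap (R := ZMod p)
          (Pi.single i 1 : Fin n → ZMod p) (Pi.single j 1)
        rw [Pi.single_eq_of_ne (Ne.symm hij), zero_smul, zero_sub, mul_neg, sub_neg_eq_add,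
          ← mul_assoc, eq_neg_of_add_eq_zero_left hanti, neg_mul, mul_assoc, ← sub_eq_add_neg,
          ← mul_sub]
        exact hL j (List.mem_of_ne_of_mem hij hj) _
    · intro v h
      have hqv : LinearMap.rTensor _ q v = 0 := by
        rw [LinearMap.rTensor_comp, LinearMap.comp_apply]
        exact (congrArg _ (h i)).trans (map_zero _)
      rw [LinearMap.rTensor_comp, LinearMap.comp_apply, LinearMap.rTensor_sub,
        LinearMap.sub_apply, hqv, sub_zero, LinearMap.rTensor_id, LinearMap.id_apply, hv v h]

lemma ι_eq_sum (v : Fin n → ZMod p) :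
    ExteriorAlgebra.ι (ZMod p) v =
      ∑ i, v i • ExteriorAlgebra.ι (ZMod p) (Pi.single i (1 : ZMod p)) := by
  conv_lhs => rw [pi_eq_sum_univ' v]
  rw [map_sum]
  refine Finset.sum_congr rfl fun i _ => ?_
  rw [map_smul]

lemma eq_one_tmul_of_contract_eq_zero {v : ExtA p n} (h : ∀ i, contract p n i v = 0) :
    v = 1 ⊗ₜ polyRetract p n v := by
  obtain ⟨T, h1, hT, hv⟩ :=
    exists_projection_of_contract_eq_zero (p := p) (Finset.univ : Finset (Fin n)).toList
  have hTa : ∀ a, T a = algebraMap (ZMod p) _ (ExteriorAlgebra.algebraMapInv a) := by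
    intro a
    induction a using CliffordAlgebra.left_induction with
    | algebraMap r =>
      rw [Algebra.algebraMap_eq_smul_one, map_smul, h1, map_smul, map_one, smul_eq_mul, mul_one,
        Algebra.algebraMap_eq_smul_one]
    | add x y hx hy => rw [map_add, hx, hy, map_add, map_add]
    | ι_mul x v _ =>
      change T (ExteriorAlgebra.ι (ZMod p) v * x) =
        algebraMap _ _ (ExteriorAlgebra.algebraMapInv (ExteriorAlgebra.ι (ZMod p) v * x))
      have h2 : ExteriorAlgebra.algebraMapInv (ExteriorAlgebra.ι (ZMod p) v * x) = 0 := by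
        rw [map_mul]; simp [ExteriorAlgebra.algebraMapInv]
      rw [h2, map_zero, ι_eq_sum, Finset.sum_mul, map_sum]
      refine Finset.sum_eq_zero fun j _ => ?_
      rw [smul_mul_assoc, map_smul, hT j (by simp), smul_zero]
  have key : ∀ w : ExtA p n, LinearMap.rTensor _ T w = 1 ⊗ₜ polyRetract p n w := by
    intro w
    induction w using TensorProduct.induction_on with
    | zero => simp
    | add x y hx hy => rw [map_add, map_add, hx, hy, TensorProduct.tmul_add]
    | tmul a f =>
      rw [LinearMap.rTensor_tmul, polyRetract_tmul, hTa, Algebra.algebraMap_eq_smul_one,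
        TensorProduct.smul_tmul]
  rw [← key, hv v h]

/-- The span of the elements of degree `k` and of exterior degree at most `r`. -/
noncomputable def extFilt (p n k r : ℕ) : Submodule (ZMod p) (ExtA p n) :=
  Submodule.span (ZMod p)
    { z | ∃ i j : ℕ, i ≤ r ∧ i + 2 * j = k ∧
        ∃ (a : ExteriorAlgebra (ZMod p) (Fin n → ZMod p))
          (f : MvPolynomial (Fin n) (ZMod p)),
          a ∈ (LinearMap.range (ExteriorAlgebra.ι (ZMod p) :
                (Fin n → ZMod p) →ₗ[ZMod p] ExteriorAlgebra (ZMod p) (Fin n → ZMod p))) ^ i ∧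
          f.IsHomogeneous j ∧ z = a ⊗ₜ f }

lemma extComp_le_extFilt {p n : ℕ} (k : ℕ) : extComp p n k ≤ extFilt p n k k := by
  refine Submodule.span_mono ?_
  rintro z ⟨i, j, hij, h⟩
  exact ⟨i, j, by omega, hij, h⟩

lemma isHomogeneous_polyRetract {k r : ℕ} {v : ExtA p n} (hv : v ∈ extFilt p n k r) :
    (polyRetract p n v).IsHomogeneous (k / 2) := by
  rw [← mem_homogeneousSubmodule]
  induction hv using Submodule.span_induction with
  | mem z hz =>
    obtain ⟨i, j, -, hij, a, f, ha, hf, rfl⟩ := hz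
    rw [polyRetract_tmul]
    rcases i with - | i
    · have : k / 2 = j := by omega
      rw [this]
      exact Submodule.smul_mem _ _ hf
    · rw [algebraMapInv_eq_zero_of_mem_range_pow i ha, zero_smul]
      exact Submodule.zero_mem _
  | zero => rw [map_zero]; exact Submodule.zero_mem _
  | add x y _ _ hx hy => rw [map_add]; exact Submodule.add_mem _ hx hy
  | smul c x _ hx => rw [map_smul]; exact Submodule.smul_mem _ _ hx

/-- The Milnor primitive `Q_j`. -/
noncomputable def milnorQ (p n j : ℕ) : ExtA p n →ₗ[ZMod p] ExtA p n :=
  ∑ i, LinearMap.mulLeft (ZMod p) (1 ⊗ₜ (X i ^ p ^ j)) ∘ₗ contract p n i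

lemma milnorQ_apply (j : ℕ) (v : ExtA p n) :
    milnorQ p n j v = ∑ i, 1 ⊗ₜ (X i ^ p ^ j) * contract p n i v := by
  simp [milnorQ, LinearMap.sum_apply]

lemma milnorQ_tmul (j : ℕ) (a : ExteriorAlgebra (ZMod p) (Fin n → ZMod p))
    (f : MvPolynomial (Fin n) (ZMod p)) :
    milnorQ p n j (a ⊗ₜ f) =
      ∑ i, CliffordAlgebra.contractLeft (LinearMap.proj i) a ⊗ₜ (X i ^ p ^ j * f) := by
  rw [milnorQ_apply]
  refine Finset.sum_congr rfl fun i _ => ?_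
  rw [contract_tmul, Algebra.TensorProduct.tmul_mul_tmul, one_mul]

lemma milnorQ_mem_extFilt (j : ℕ) {k r : ℕ} {v : ExtA p n} (hv : v ∈ extFilt p n k (r + 1)) :
    milnorQ p n j v ∈ extFilt p n (k - 1 + 2 * p ^ j) r := by
  induction hv using Submodule.span_induction with
  | mem z hz =>
    obtain ⟨i, d, hir, hid, a, f, ha, hf, rfl⟩ := hz
    rw [milnorQ_tmul]
    refine Submodule.sum_mem _ fun l _ => ?_
    rcases i with - | i
    · rw [pow_zero] at ha
      obtain ⟨c, rfl⟩ := Submodule.mem_one.1 ha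
      rw [CliffordAlgebra.contractLeft_algebraMap, TensorProduct.zero_tmul]
      exact Submodule.zero_mem _
    · refine Submodule.subset_span ⟨i, p ^ j + d, by omega, by omega, _, _,
        contractLeft_mem_range_pow _ _ ha, (isHomogeneous_X_pow _ _).mul hf, rfl⟩
  | zero => rw [map_zero]; exact Submodule.zero_mem _
  | add x y _ _ hx hy => rw [map_add]; exact Submodule.add_mem _ hx hy
  | smul c x _ hx => rw [map_smul]; exact Submodule.smul_mem _ _ hx

lemma milnorQ_eq_zero_of_mem_extFilt_zero (j : ℕ) {k : ℕ} {v : ExtA p n}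
    (hv : v ∈ extFilt p n k 0) : milnorQ p n j v = 0 := by
  induction hv using Submodule.span_induction with
  | mem z hz =>
    obtain ⟨i, d, hir, hid, a, f, ha, hf, rfl⟩ := hz
    obtain rfl : i = 0 := by omega
    rw [pow_zero] at ha
    obtain ⟨c, rfl⟩ := Submodule.mem_one.1 ha
    rw [milnorQ_tmul]
    refine Finset.sum_eq_zero fun l _ => ?_
    rw [CliffordAlgebra.contractLeft_algebraMap, TensorProduct.zero_tmul]
  | zero => rw [map_zero]
  | add x y _ _ hx hy => rw [map_add, hx, hy, add_zero]
  | smul c x _ hx => rw [map_smul, hx, smul_zero]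

lemma contract_eq_zero_of_milnorQ_eq_zero {v : ExtA p n} (hv : ∀ j, milnorQ p n j v = 0)
    (i : Fin n) : contract p n i v = 0 := by
  let A : Matrix (Fin n) (Fin n) (MvPolynomial (Fin n) (ZMod p)) :=
    Matrix.of fun i l => X i ^ p ^ (l : ℕ)
  have hA : A.det ≠ 0 := det_X_pow_ne_zero (e := fun l : Fin n => p ^ (l : ℕ))
    ((Nat.pow_right_injective (Fact.out : p.Prime).two_le).comp Fin.val_injective)
  have hinj : Function.Injective
      (LinearMap.lTensor (ExteriorAlgebra (ZMod p) (Fin n → ZMod p))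
        (LinearMap.mulLeft (ZMod p) A.det)) :=
    Module.Flat.lTensor_preserves_injective_linearMap _ (mul_right_injective₀ hA)
  have hmul : ∀ w : ExtA p n, LinearMap.lTensor _ (LinearMap.mulLeft (ZMod p) A.det) w =
      1 ⊗ₜ A.det * w := by
    intro w
    induction w using TensorProduct.induction_on with
    | zero => simp
    | add x y hx hy => rw [map_add, mul_add, hx, hy]
    | tmul a f => simp
  apply hinj
  rw [map_zero, hmul]
  have h1 : ∑ j : Fin n, (1 ⊗ₜ A.adjugate j i : ExtA p n) * milnorQ p n j v = 0 := by
    simp [hv]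
  rw [← h1]
  simp_rw [milnorQ_apply, Finset.mul_sum, ← mul_assoc, Algebra.TensorProduct.tmul_mul_tmul, one_mul]
  rw [Finset.sum_comm]
  simp_rw [← Finset.sum_mul, ← TensorProduct.tmul_sum]
  have h2 : ∀ l, ∑ j : Fin n, A.adjugate j i * X l ^ p ^ (j : ℕ) = if l = i then A.det else 0 := by
    intro l
    have := congrFun (congrFun (Matrix.mul_adjugate A) l) i
    rw [Matrix.mul_apply, Matrix.smul_apply, Matrix.one_apply] at this
    simpa [A, mul_comm] using this
  simp_rw [h2]
  rw [Finset.sum_eq_single i]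
  · simp
  · intro l _ hl
    simp [hl]
  · simp

/-- A nonzero homogeneous element of a subspace stable under the Milnor primitives yields a
nonzero element in the polynomial factor. -/
lemma exists_one_tmul_mem {M : Submodule (ZMod p) (ExtA p n)}
    (hM : ∀ j, ∀ z ∈ M, milnorQ p n j z ∈ M) {k r : ℕ} {v : ExtA p n} (hv : v ∈ M)
    (hvk : v ∈ extFilt p n k r) (hv0 : v ≠ 0) :
    ∃ f : MvPolynomial (Fin n) (ZMod p), f ≠ 0 ∧ (∃ d, f.IsHomogeneous d) ∧ 1 ⊗ₜ f ∈ M := by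
  induction r using Nat.strong_induction_on generalizing k v with
  | _ r ih =>
    by_cases h : ∀ j, milnorQ p n j v = 0
    · have h1 := eq_one_tmul_of_contract_eq_zero (contract_eq_zero_of_milnorQ_eq_zero h)
      refine ⟨polyRetract p n v, fun h0 => hv0 ?_, ⟨_, isHomogeneous_polyRetract hvk⟩, h1 ▸ hv⟩
      rw [h1, h0, TensorProduct.tmul_zero]
    · push Not at h
      obtain ⟨j, hj⟩ := h
      rcases r with - | r
      · exact absurd (milnorQ_eq_zero_of_mem_extFilt_zero j hvk) hj
      · exact ih r (Nat.lt_succ_self r) (hM j v hv) (milnorQ_mem_extFilt j hvk) hj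

end ExteriorFactor

section SteenrodOperations

variable {p n : ℕ} [Fact p.Prime]

lemma one_mem_extComp : (1 : ExtA p n) ∈ extComp p n 0 :=
  Submodule.subset_span ⟨0, 0, rfl, 1, 1, by rw [pow_zero]; exact Submodule.one_le.1 le_rfl,
    isHomogeneous_one _ _, rfl⟩

lemma xgen_mem_extComp (i : Fin n) : xgen p n i ∈ extComp p n 1 :=
  Submodule.subset_span ⟨1, 0, rfl, _, 1, by rw [pow_one]; exact ⟨_, rfl⟩,
    isHomogeneous_one _ _, rfl⟩

lemma ygen_mem_extComp (i : Fin n) : ygen p n i ∈ extComp p n 2 :=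
  Submodule.subset_span ⟨0, 1, rfl, 1, _, by rw [pow_zero]; exact Submodule.one_le.1 le_rfl,
    isHomogeneous_X _ _, rfl⟩

lemma bockstein_eq_milnorQ_zero {β : ExtA p n →ₗ[ZMod p] ExtA p n}
    (hβx : ∀ i : Fin n, β (xgen p n i) = ygen p n i)
    (hβy : ∀ i : Fin n, β (ygen p n i) = 0)
    (hβLeib : ∀ (k : ℕ) (a b : ExtA p n), a ∈ extComp p n k →
      β (a * b) = β a * b + ((-1 : ZMod p) ^ k) • (a * β b)) : β = milnorQ p n 0 := by
  have hβ1 : β 1 = 0 := by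
    have := hβLeib 0 1 1 one_mem_extComp
    simpa using this
  have hβS : ∀ f : MvPolynomial (Fin n) (ZMod p), β (1 ⊗ₜ f) = 0 := by
    intro f
    induction f using MvPolynomial.induction_on with
    | C a =>
      have : (1 ⊗ₜ C a : ExtA p n) = a • 1 := by
        rw [Algebra.TensorProduct.one_def, ← TensorProduct.tmul_smul, smul_eq_C_mul, mul_one]
      rw [this, map_smul, hβ1, smul_zero]
    | add f g hf hg => rw [TensorProduct.tmul_add, map_add, hf, hg, add_zero]
    | mul_X f i hf =>
      have : (1 ⊗ₜ (f * X i) : ExtA p n) = ygen p n i * 1 ⊗ₜ f := by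
        rw [ygen, Algebra.TensorProduct.tmul_mul_tmul, one_mul, mul_comm]
      rw [this, hβLeib 2 _ _ (ygen_mem_extComp i), hβy, hf, zero_mul, mul_zero, smul_zero,
        add_zero]
  have hβxmul : ∀ i b, β (xgen p n i * b) = ygen p n i * b - xgen p n i * β b := by
    intro i b
    rw [hβLeib 1 _ _ (xgen_mem_extComp i), hβx, pow_one]
    module
  refine TensorProduct.ext' fun a f => ?_
  induction a using CliffordAlgebra.left_induction with
  | algebraMap r =>
    rw [Algebra.algebraMap_eq_smul_one, TensorProduct.smul_tmul, hβS, milnorQ_tmul]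
    simp
  | add x y hx hy => rw [TensorProduct.add_tmul, map_add, map_add, hx, hy]
  | ι_mul x v hx =>
    change β ((ExteriorAlgebra.ι (ZMod p) v * x) ⊗ₜ f) =
      milnorQ p n 0 ((ExteriorAlgebra.ι (ZMod p) v * x) ⊗ₜ f)
    have hsum : ((ExteriorAlgebra.ι (ZMod p) v * x) ⊗ₜ f : ExtA p n) =
        ∑ i, v i • (xgen p n i * x ⊗ₜ f) := by
      rw [ι_eq_sum, Finset.sum_mul, TensorProduct.sum_tmul]
      refine Finset.sum_congr rfl fun i _ => ?_
      rw [xgen, Algebra.TensorProduct.tmul_mul_tmul, one_mul, smul_mul_assoc,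
        TensorProduct.smul_tmul']
    rw [hsum, map_sum, map_sum]
    refine Finset.sum_congr rfl fun i _ => ?_
    rw [map_smul, map_smul, hβxmul, hx, xgen,
      Algebra.TensorProduct.tmul_mul_tmul, one_mul, milnorQ_tmul, milnorQ_tmul]
    have hc : ∀ l, CliffordAlgebra.contractLeft (LinearMap.proj l)
        (ExteriorAlgebra.ι (ZMod p) (Pi.single i 1 : Fin n → ZMod p) * x) =
        (Pi.single i 1 : Fin n → ZMod p) l • x - ExteriorAlgebra.ι (ZMod p) (Pi.single i 1) *
          CliffordAlgebra.contractLeft (LinearMap.proj l) x :=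
      fun l => CliffordAlgebra.contractLeft_ι_mul _ _ _
    simp_rw [hc, TensorProduct.sub_tmul]
    have hi : ∑ l, ((Pi.single i 1 : Fin n → ZMod p) l • x) ⊗ₜ[ZMod p]
        (X l ^ p ^ 0 * f : MvPolynomial (Fin n) (ZMod p)) = x ⊗ₜ (X i ^ p ^ 0 * f) := by
      rw [Finset.sum_eq_single i (fun l _ hl => by
        rw [Pi.single_eq_of_ne hl, zero_smul, TensorProduct.zero_tmul]) (by simp),
        Pi.single_eq_same, one_smul]
    rw [Finset.sum_sub_distrib, hi, Finset.mul_sum, ygen, Algebra.TensorProduct.tmul_mul_tmul,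
      one_mul]
    simp_rw [Algebra.TensorProduct.tmul_mul_tmul, one_mul, pow_zero, pow_one]

lemma totalPower_coeff_zero (f : MvPolynomial (Fin n) (ZMod p)) :
    (totalPower p f).coeff 0 = f := by
  induction f using MvPolynomial.induction_on with
  | C a =>
    rw [totalPower, algHom_C, IsScalarTower.algebraMap_apply (ZMod p)
      (MvPolynomial (Fin n) (ZMod p)), Polynomial.algebraMap_eq, Polynomial.coeff_C_zero]
    rfl
  | add f g hf hg => rw [map_add, Polynomial.coeff_add, hf, hg]
  | mul_X f i hf =>
    rw [map_mul, Polynomial.mul_coeff_zero, hf]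
    simp [totalPower]

lemma coeff_totalPower_X_pow_mul (i : Fin n) (j : ℕ) (f : MvPolynomial (Fin n) (ZMod p)) :
    (totalPower p (X i ^ p ^ j * f)).coeff (p ^ j) =
      X i ^ p ^ j * (totalPower p f).coeff (p ^ j) + X i ^ p ^ (j + 1) * f := by
  have hX : totalPower p (X i ^ p ^ j : MvPolynomial (Fin n) (ZMod p)) =
      Polynomial.C (X i ^ p ^ j) + Polynomial.C (X i ^ p ^ (j + 1)) * Polynomial.X ^ p ^ j := by
    rw [map_pow, totalPower, aeval_X, add_pow_char_pow, mul_pow, ← Polynomial.C_pow,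
      ← Polynomial.C_pow, ← pow_mul, pow_succ']
  rw [map_mul, hX, add_mul, Polynomial.coeff_add, Polynomial.coeff_C_mul, mul_assoc,
    Polynomial.coeff_C_mul]
  have := Polynomial.coeff_X_pow_mul (totalPower p f) (p ^ j) 0
  rw [zero_add] at this
  rw [this, totalPower_coeff_zero]

variable {Pt : ExtA p n →ₐ[ZMod p] Polynomial (ExtA p n)}

lemma coeff_totalPower_tmul (hPtx : ∀ i : Fin n, Pt (xgen p n i) = Polynomial.C (xgen p n i))
    (hPty : ∀ i : Fin n, Pt (ygen p n i) =
      Polynomial.C (ygen p n i) + Polynomial.C (ygen p n i ^ p) * Polynomial.X)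
    (a : ExteriorAlgebra (ZMod p) (Fin n → ZMod p)) (f : MvPolynomial (Fin n) (ZMod p)) (k : ℕ) :
    (Pt (a ⊗ₜ f)).coeff k = a ⊗ₜ (totalPower p f).coeff k := by
  have ha : Pt.comp Algebra.TensorProduct.includeLeft =
      (Polynomial.CAlgHom (R := ZMod p)).comp (Algebra.TensorProduct.includeLeft :
        ExteriorAlgebra (ZMod p) (Fin n → ZMod p) →ₐ[ZMod p] ExtA p n) := by
    refine ExteriorAlgebra.hom_ext (LinearMap.pi_ext' fun i => LinearMap.ext_ring ?_)
    exact hPtx i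
  have hf : Pt.comp Algebra.TensorProduct.includeRight =
      (Polynomial.mapAlgHom (Algebra.TensorProduct.includeRight :
        MvPolynomial (Fin n) (ZMod p) →ₐ[ZMod p] ExtA p n)).comp (totalPower p) := by
    refine MvPolynomial.algHom_ext fun i => ?_
    refine (hPty i).trans ?_
    rw [ygen, Algebra.TensorProduct.tmul_pow, one_pow]
    simp [totalPower, -map_pow]
  have h : Pt (a ⊗ₜ f) = Polynomial.C (a ⊗ₜ 1) *
      Polynomial.mapAlgHom (Algebra.TensorProduct.includeRight :
        MvPolynomial (Fin n) (ZMod p) →ₐ[ZMod p] ExtA p n) (totalPower p f) := by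
    rw [← one_mul f, ← mul_one a, ← Algebra.TensorProduct.tmul_mul_tmul, map_mul, mul_one, one_mul]
    exact congrArg₂ (· * ·) (DFunLike.congr_fun ha a) (DFunLike.congr_fun hf f)
  rw [h, Polynomial.coeff_C_mul, Polynomial.coe_mapAlgHom, Polynomial.coeff_map]
  simp

lemma milnorQ_succ (hPtx : ∀ i : Fin n, Pt (xgen p n i) = Polynomial.C (xgen p n i))
    (hPty : ∀ i : Fin n, Pt (ygen p n i) =
      Polynomial.C (ygen p n i) + Polynomial.C (ygen p n i ^ p) * Polynomial.X)
    (j : ℕ) (z : ExtA p n) :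
    milnorQ p n (j + 1) z =
      (Pt (milnorQ p n j z)).coeff (p ^ j) - milnorQ p n j ((Pt z).coeff (p ^ j)) := by
  induction z using TensorProduct.induction_on with
  | zero => simp
  | add x y hx hy =>
    simp only [map_add, Polynomial.coeff_add, hx, hy]
    abel
  | tmul a f =>
    rw [coeff_totalPower_tmul hPtx hPty, milnorQ_tmul, milnorQ_tmul, milnorQ_tmul, map_sum,
      Polynomial.finsetSum_coeff, ← Finset.sum_sub_distrib]
    refine Finset.sum_congr rfl fun i _ => ?_
    rw [coeff_totalPower_tmul hPtx hPty, coeff_totalPower_X_pow_mul, TensorProduct.tmul_add,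
      add_sub_cancel_left]

lemma constantCoeff_eq_zero_of_mem_extDnPlus {f : MvPolynomial (Fin n) (ZMod p)}
    (hf : 1 ⊗ₜ f ∈ extDnPlus p n) : constantCoeff f = 0 := by
  let ε : ExtA p n →ₗ[ZMod p] ZMod p := lcoeff (ZMod p) 0 ∘ₗ polyRetract p n
  have hle : (⨆ (k : ℕ) (_ : 0 < k), extComp p n k) ≤ LinearMap.ker ε := by
    refine iSup₂_le fun k hk => Submodule.span_le.2 ?_
    rintro _ ⟨i, j, hij, a, g, ha, hg, rfl⟩
    change coeff 0 (polyRetract p n (a ⊗ₜ g)) = 0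
    rw [polyRetract_tmul]
    rcases i with - | i
    · rw [coeff_smul, hg.coeff_eq_zero (by simp; omega), smul_zero]
    · rw [algebraMapInv_eq_zero_of_mem_range_pow i ha, zero_smul, coeff_zero]
  have := hle hf.2
  rwa [LinearMap.mem_ker, LinearMap.comp_apply, polyRetract_one_tmul] at this

lemma aeval_eq_self_of_mem_extDnPlus {f : MvPolynomial (Fin n) (ZMod p)}
    (hf : 1 ⊗ₜ f ∈ extDnPlus p n) (g : GL (Fin n) (ZMod p)) :
    aeval (fun i => ∑ j, C (g.1 j i) * X j) f = f := by
  have h := (Submodule.mem_iInf _).1 hf.1 g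
  rw [LinearMap.mem_ker, LinearMap.sub_apply, sub_eq_zero, LinearMap.id_apply] at h
  have h1 := congrArg (polyRetract p n) h
  rw [AlgHom.toLinearMap_apply, glActExt, Algebra.TensorProduct.map_tmul, map_one,
    polyRetract_one_tmul, polyRetract_one_tmul] at h1
  exact h1

/-- A nonzero graded Steenrod submodule of `D_n⁺` contains powers of all high enough Moore
determinants. -/
lemma exists_one_tmul_det_pow_mem {β : ExtA p n →ₗ[ZMod p] ExtA p n}
    (hβx : ∀ i : Fin n, β (xgen p n i) = ygen p n i)
    (hβy : ∀ i : Fin n, β (ygen p n i) = 0)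
    (hβLeib : ∀ (k : ℕ) (a b : ExtA p n), a ∈ extComp p n k →
      β (a * b) = β a * b + ((-1 : ZMod p) ^ k) • (a * β b))
    (hPtx : ∀ i : Fin n, Pt (xgen p n i) = Polynomial.C (xgen p n i))
    (hPty : ∀ i : Fin n, Pt (ygen p n i) =
      Polynomial.C (ygen p n i) + Polynomial.C (ygen p n i ^ p) * Polynomial.X)
    {M : Submodule (ZMod p) (ExtA p n)} (hM : M ≤ extDnPlus p n)
    (hMgr : M = ⨆ k : ℕ, M ⊓ extComp p n k) (hMβ : ∀ x ∈ M, β x ∈ M)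
    (hMP : ∀ k : ℕ, ∀ x ∈ M, (Pt x).coeff k ∈ M) (hM0 : M ≠ ⊥) :
    ∃ m, ∀ N : Fin n → ℕ, (∀ l, m < N l) →
      1 ⊗ₜ ((Matrix.of fun i l => (X i : MvPolynomial (Fin n) (ZMod p)) ^ p ^ N l).det ^ (p - 1))
        ∈ M := by
  have hQ : ∀ j, ∀ z ∈ M, milnorQ p n j z ∈ M := by
    intro j
    induction j with
    | zero => rwa [← bockstein_eq_milnorQ_zero hβx hβy hβLeib]
    | succ j ih =>
      intro z hz
      rw [milnorQ_succ hPtx hPty]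
      exact M.sub_mem (hMP _ _ (ih z hz)) (ih _ (hMP _ z hz))
  obtain ⟨k, v, hv, hv0⟩ : ∃ k, ∃ v ∈ M ⊓ extComp p n k, v ≠ 0 := by
    by_contra! h
    exact hM0 (hMgr.trans (iSup_eq_bot.2 fun k => (Submodule.eq_bot_iff _).2 (h k)))
  obtain ⟨f, hf0, hfd, hf⟩ := exists_one_tmul_mem hQ hv.1 (extComp_le_extFilt k hv.2) hv0
  let s : Set (MvPolynomial (Fin n) (ZMod p)) := {g | (∃ d, g.IsHomogeneous d) ∧ 1 ⊗ₜ g ∈ M}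
  have hs : Submodule.span (ZMod p) s ≤
      M.comap (Algebra.TensorProduct.includeRight : _ →ₐ[ZMod p] ExtA p n).toLinearMap :=
    Submodule.span_le.2 fun g hg => hg.2
  obtain ⟨m, hm⟩ := exists_det_pow_mem_span p s (fun g hg => hg.1) (by
      rintro g ⟨⟨d, hd⟩, hg⟩ k
      refine ⟨⟨_, isHomogeneous_coeff_totalPower (Fact.out : p.Prime).one_le hd k⟩, ?_⟩
      rw [← coeff_totalPower_tmul hPtx hPty]
      exact hMP k _ hg) (f := f) ⟨hfd, hf⟩ hf0
    (constantCoeff_eq_zero_of_mem_extDnPlus (hM hf)) (aeval_eq_self_of_mem_extDnPlus (hM hf))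
  exact ⟨m, fun N hN => hs (hm N hN)⟩

end SteenrodOperations

/-- The augmentation ideal `D_n⁺` of the extended Dickson algebra (`p` odd) is not directly
decomposable as a Steenrod module: given the Bockstein `β` and the total reduced power `P_t`
(so that `P^k = ` coefficient of `t^k`), if `D_n⁺ = M ⊕ N` with `M, N` graded subspaces each
stable under `β` and all `P^k`, then `M = 0` or `N = 0`. -/
theorem extended_dicksonPlus_indecomposable (p n : ℕ) [Fact p.Prime] (hp : Odd p)
    (β : ExtA p n →ₗ[ZMod p] ExtA p n)
    (hβx : ∀ i : Fin n, β (xgen p n i) = ygen p n i)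
    (hβy : ∀ i : Fin n, β (ygen p n i) = 0)
    (hβLeib : ∀ (k : ℕ) (a b : ExtA p n), a ∈ extComp p n k →
      β (a * b) = β a * b + ((-1 : ZMod p) ^ k) • (a * β b))
    (Pt : ExtA p n →ₐ[ZMod p] Polynomial (ExtA p n))
    (hPtx : ∀ i : Fin n, Pt (xgen p n i) = Polynomial.C (xgen p n i))
    (hPty : ∀ i : Fin n, Pt (ygen p n i) =
      Polynomial.C (ygen p n i) + Polynomial.C (ygen p n i ^ p) * Polynomial.X)
    (M N : Submodule (ZMod p) (ExtA p n))
    (hM : M ≤ extDnPlus p n) (hN : N ≤ extDnPlus p n)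
    (hMgr : M = ⨆ k : ℕ, M ⊓ extComp p n k)
    (hNgr : N = ⨆ k : ℕ, N ⊓ extComp p n k)
    (hMβ : ∀ x ∈ M, β x ∈ M) (hNβ : ∀ x ∈ N, β x ∈ N)
    (hMP : ∀ k : ℕ, ∀ x ∈ M, (Pt x).coeff k ∈ M)
    (hNP : ∀ k : ℕ, ∀ x ∈ N, (Pt x).coeff k ∈ N)
    (hsum : M ⊔ N = extDnPlus p n) (hdisj : M ⊓ N = ⊥) :
    M = ⊥ ∨ N = ⊥ := by
  by_contra! h
  obtain ⟨m, hm⟩ := exists_one_tmul_det_pow_mem hβx hβy hβLeib hPtx hPty hM hMgr hMβ hMP h.1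
  obtain ⟨m', hm'⟩ := exists_one_tmul_det_pow_mem hβx hβy hβLeib hPtx hPty hN hNgr hNβ hNP h.2
  let e : Fin n → ℕ := fun l => max m m' + 1 + l
  have h0 := (Submodule.mem_bot (ZMod p)).1 (hdisj ▸ Submodule.mem_inf.2
    ⟨hm e fun l => by simp only [e]; omega, hm' e fun l => by simp only [e]; omega⟩)
  have h1 := congrArg (polyRetract p n) h0
  rw [polyRetract_one_tmul, map_zero] at h1
  refine det_X_pow_ne_zero (e := fun l => p ^ e l) ?_ (eq_zero_of_pow_eq_zero h1)
  exact (Nat.pow_right_injective (Fact.out : p.Prime).two_le).comp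
    ((add_right_injective _).comp Fin.val_injective)
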